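/- arXiv:2204.12936 — 4 statements merged into one kernel-verified Lean document; each statement's English description precedes it below -/
import Mathlib

section
/- For any k ≥ 1 and n ≥ 1, the number of permutations of size n having exactly 2^(k−1) preimages under the bubblesort operator B equals the unsigned Stirling number of the first kind [n−1 choose k−1] (i.e., the number of permutations of size n−1 with k−1 cycles). -/
/-- One pass of bubblesort on a list of naturals. -/
def bpass : List ℕ → List ℕ
  | [] => []
  | [a] => [a]
  | a :: b :: l => if b < a then b :: bpass (a :: l) else a :: bpass (b :: l)

/-- The identity permutation 1 2 ... n as a list. -/
def idList (n : ℕ) : List ℕ := List.map (· + 1) (List.range n)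

/-- `l` is (the word of) a permutation of size `n`, i.e. a rearrangement of 1,...,n. -/
def IsPermList (n : ℕ) (l : List ℕ) : Prop := l.Perm (idList n)

/-- position `j` of `l` holds a left-to-right maximum. -/
def IsLTRMax (l : List ℕ) (j : ℕ) : Prop :=
  j < l.length ∧ ∀ i < j, l.getD i 0 < l.getD j 0

instance (l : List ℕ) (j : ℕ) : Decidable (IsLTRMax l j) := by
  unfold IsLTRMax; infer_instance

/-- the number of left-to-right maxima of `l`. -/
def ltrCount (l : List ℕ) : ℕ :=
  ((List.range l.length).filter fun j => decide (IsLTRMax l j)).length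

/-- the length of the longest suffix of `l` consisting of left-to-right maxima. -/
def suffLen (l : List ℕ) : ℕ :=
  ((List.range l.length).takeWhile fun j => decide (IsLTRMax l (l.length - 1 - j))).length

/-- `σ` is a node of the tree `T(π)` of iterated bubblesort preimages. -/
def IsNode (n : ℕ) (π σ : List ℕ) : Prop :=
  IsPermList n σ ∧ ∃ j, bpass^[j] σ = π

/-- `σ` is a node of `T(π)` at height `j` (j passes needed to reach π, and no fewer). -/
def IsNodeAt (n : ℕ) (π σ : List ℕ) (j : ℕ) : Prop :=
  IsPermList n σ ∧ bpass^[j] σ = π ∧ ∀ i < j, bpass^[i] σ ≠ π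

/-- `τ` is a leaf: it has no child, i.e. no bubblesort preimage other than itself. -/
def IsLeafNode (n : ℕ) (τ : List ℕ) : Prop :=
  ¬ ∃ ρ, IsPermList n ρ ∧ ρ ≠ τ ∧ bpass ρ = τ

/-- `T(π)` and `T(τ)` are isomorphic as rooted trees: there is a bijection between
their node sets sending root to root and commuting with the parent map `bpass`. -/
def TreeIso (n : ℕ) (π τ : List ℕ) : Prop :=
  ∃ φ : List ℕ → List ℕ,
    (∀ σ, IsNode n π σ → IsNode n τ (φ σ)) ∧
    (∀ σ σ', IsNode n π σ → IsNode n π σ' → φ σ = φ σ' → σ = σ') ∧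
    (∀ ρ, IsNode n τ ρ → ∃ σ, IsNode n π σ ∧ φ σ = ρ) ∧
    φ π = τ ∧
    (∀ σ, IsNode n π σ → σ ≠ π → φ (bpass σ) = bpass (φ σ))

/-- The number of cycles of a permutation (including fixed points). -/
def cycleCount {m : ℕ} (g : Equiv.Perm (Fin m)) : ℕ :=
  g.cycleType.card + (Finset.univ.filter fun x => g x = x).card


open Equiv in
theorem isCycle_swap_mul_aux {α : Type*} [DecidableEq α] (c : Perm α) (z p : α)
    (hz : c z = z) (hp : c p ≠ p) (hc : c.IsCycle) : (swap z p * c).IsCycle := by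
  have hzp : p ≠ z := by rintro rfl; exact hp hz
  set g := swap z p * c with hg
  have g0 : g z = p := by simp [hg, hz]
  have step : ∀ x, x ≠ z → g.SameCycle x (c x) := by
    intro x hx
    have hcx : c x ≠ z := fun h => hx (c.injective (h.trans hz.symm))
    by_cases h : c x = p
    · have h1 : g x = z := by simp [hg, h]
      refine ⟨2, ?_⟩
      rw [h, ← g0, ← h1]
      rfl
    · refine ⟨1, ?_⟩
      simp [hg, swap_apply_of_ne_of_ne hcx h]
  have hpow : ∀ (i : ℕ) x, x ≠ z → (c ^ i) x ≠ z ∧ g.SameCycle x ((c ^ i) x) := by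
    intro i
    induction i with
    | zero => intro x hx; exact ⟨hx, Perm.SameCycle.refl _ _⟩
    | succ i ih =>
      intro x hx
      obtain ⟨h1, h2⟩ := ih x hx
      rw [pow_succ', Perm.mul_apply]
      exact ⟨fun h => h1 (c.injective (h.trans hz.symm)), h2.trans (step _ h1)⟩
  have hsame : ∀ x y, x ≠ z → y ≠ z → c.SameCycle x y → g.SameCycle x y := by
    rintro x y hx hy ⟨i, rfl⟩
    obtain ⟨j, rfl | rfl⟩ := i.eq_nat_or_neg
    · simpa using (hpow j x hx).2
    · have := (hpow j _ hy).2
      simp at this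
      simpa using this.symm
  refine ⟨z, by rw [g0]; exact hzp, ?_⟩
  intro y hy
  by_cases hyz : y = z
  · subst hyz; exact Perm.SameCycle.refl _ _
  have h0 : g.SameCycle z p := ⟨1, by simp [g0]⟩
  refine h0.trans (hsame p y hzp hyz (hc.sameCycle hp ?_))
  intro hcy
  apply hy
  have : y ≠ p := by rintro rfl; exact hp hcy
  simp [hg, hcy, swap_apply_of_ne_of_ne hyz this]

open Equiv in
theorem card_cycleType_swap_mul {α : Type*} [DecidableEq α] [Fintype α] (s : Perm α) (z p : α)
    (hz : s z = z) (hzp : p ≠ z) :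
    (swap z p * s).cycleType.card + (if s p = p then 0 else 1) = s.cycleType.card + 1 := by
  split_ifs with h
  · have hd : Perm.Disjoint (swap z p) s := by
      intro x
      by_cases h1 : x = z
      · subst h1; exact Or.inr hz
      by_cases h2 : x = p
      · subst h2; exact Or.inr h
      · exact Or.inl (swap_apply_of_ne_of_ne h1 h2)
    rw [hd.cycleType_mul, (Perm.isCycle_swap hzp.symm).cycleType]
    simp [add_comm]
  · set c := s.cycleOf p with hcdef
    have hc : c.IsCycle := Perm.isCycle_cycleOf s h
    have hcm : c ∈ s.cycleFactorsFinset := Perm.cycleOf_mem_cycleFactorsFinset_iff.2 (by simpa using h)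
    have hd : Perm.Disjoint (s * c⁻¹) c := Perm.disjoint_mul_inv_of_mem_cycleFactorsFinset hcm
    set r := s * c⁻¹ with hr
    have hs : s = c * r := by rw [← hd.commute.eq, hr]; simp
    have hcp : c p ≠ p := by simpa [hcdef] using h
    have hcz : c z = z := by
      rcases hd.symm z with h' | h'
      · exact h'
      · have := hz; rw [hs, Perm.mul_apply, h'] at this; exact this
    have hrz : r z = z := by
      have := hz; rw [hs, ← hd.commute.eq, Perm.mul_apply, hcz] at this; exact this
    have hrp : r p = p := (hd p).resolve_right hcp
    have hg := isCycle_swap_mul_aux c z p hcz hcp hc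
    have hd2 : Perm.Disjoint (swap z p * c) r := by
      intro x
      rcases hd x with h' | h'
      · exact Or.inr h'
      by_cases h1 : x = z
      · subst h1; exact Or.inr hrz
      by_cases h2 : x = p
      · subst h2; exact Or.inr hrp
      left
      simp [h', swap_apply_of_ne_of_ne h1 h2]
    rw [hs, ← mul_assoc, hd2.cycleType_mul, hd.symm.cycleType_mul, hg.cycleType, hc.cycleType]
    simp

open Equiv in
theorem card_fixed_swap_mul {α : Type*} [DecidableEq α] [Fintype α] (s : Perm α) (z p : α)
    (hz : s z = z) (hzp : p ≠ z) :
    (Finset.univ.filter fun x => (swap z p * s) x = x).card + 1 + (if s p = p then 1 else 0) =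
      (Finset.univ.filter fun x => s x = x).card := by
  have key : (Finset.univ.filter fun x => (swap z p * s) x = x) =
      ((Finset.univ.filter fun x => s x = x).erase z).erase p := by
    ext x
    rw [Finset.mem_erase, Finset.mem_erase, Finset.mem_filter_univ, Finset.mem_filter_univ, Perm.mul_apply]
    constructor
    · intro h
      have hxz : x ≠ z := by rintro rfl; rw [hz] at h; simp at h; exact hzp h
      have hsz : s x ≠ z := fun h' => hxz (s.injective (h'.trans hz.symm))
      have hsp : s x ≠ p := by
        intro h'; rw [h'] at h; simp at h; exact hxz h.symm
      rw [swap_apply_of_ne_of_ne hsz hsp] at h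
      exact ⟨by rintro rfl; exact hsp h, hxz, h⟩
    · rintro ⟨h1, h2, h3⟩
      rw [h3, swap_apply_of_ne_of_ne h2 h1]
  rw [key]
  have hzm : z ∈ Finset.univ.filter fun x => s x = x := by simp [hz]
  have c1 := Finset.card_erase_add_one hzm
  split_ifs with h
  · have hpm : p ∈ (Finset.univ.filter fun x => s x = x).erase z := by simp [h, hzp]
    have c2 := Finset.card_erase_add_one hpm
    omega
  · rw [Finset.erase_eq_of_notMem (by simp [h])]
    omega

open Equiv in
theorem decomp_mul {n : ℕ} (p : Fin (n + 1)) (e : Perm (Fin n)) :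
    Perm.decomposeFin.symm (p, e) = swap 0 p * Perm.decomposeFin.symm (0, e) := by
  ext x
  refine Fin.cases ?_ (fun x => ?_) x <;> simp [Perm.decomposeFin_symm_apply_succ]

open Equiv in
theorem decomp_zero {n : ℕ} (e : Perm (Fin n)) :
    Perm.decomposeFin.symm (0, e) = e.extendDomain (finSuccAboveEquiv (0 : Fin (n + 1))) := by
  ext x
  refine Fin.cases ?_ (fun x => ?_) x
  · rw [Perm.extendDomain_apply_not_subtype _ _ (by simp)]; simp
  · have := Perm.extendDomain_apply_image e (finSuccAboveEquiv (0 : Fin (n + 1))) x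
    simp [finSuccAboveEquiv_apply] at this
    rw [this]; simp

open Equiv in
theorem cycleCount_decomp {n : ℕ} (p : Fin (n + 1)) (e : Perm (Fin n)) :
    cycleCount (Perm.decomposeFin.symm (p, e)) = cycleCount e + if p = 0 then 1 else 0 := by
  have h0 : cycleCount (Perm.decomposeFin.symm ((0 : Fin (n + 1)), e)) = cycleCount e + 1 := by
    unfold cycleCount
    rw [decomp_zero, Perm.cycleType_extendDomain, ← decomp_zero, Fin.univ_succ,
      Finset.filter_cons, if_pos (by simp), Finset.card_cons, Finset.filter_map, Finset.card_map,
      ← add_assoc]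
    congr 3
    ext x
    simp
  split_ifs with h
  · subst h; exact h0
  · have hz : Perm.decomposeFin.symm ((0 : Fin (n + 1)), e) 0 = 0 := by simp
    have h1 := card_cycleType_swap_mul (Perm.decomposeFin.symm ((0 : Fin (n + 1)), e)) 0 p hz h
    have h2 := card_fixed_swap_mul (Perm.decomposeFin.symm ((0 : Fin (n + 1)), e)) 0 p hz h
    rw [← decomp_mul] at h1 h2
    unfold cycleCount at *
    split_ifs at h1 h2 <;> omega

open Equiv in
theorem card_cycleCount (m : ℕ) : ∀ j,
    (Finset.univ.filter fun g : Perm (Fin m) => cycleCount g = j).card = Nat.stirlingFirst m j := by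
  induction m with
  | zero =>
    intro j
    have : ∀ g : Perm (Fin 0), cycleCount g = 0 := by
      intro g; have : g = 1 := Subsingleton.elim _ _
      subst this; simp [cycleCount]
    cases j <;> simp [this]
  | succ m ih =>
    intro j
    have key : (Finset.univ.filter fun g : Perm (Fin (m + 1)) => cycleCount g = j).card =
      ∑ p : Fin (m + 1), (Finset.univ.filter fun e : Perm (Fin m) =>
        cycleCount e + (if p = 0 then 1 else 0) = j).card := by
      simp only [Finset.card_filter]
      rw [← Perm.decomposeFin.symm.sum_comp, Fintype.sum_prod_type]
      simp only [cycleCount_decomp]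
    rw [key, Fin.sum_univ_succ]
    simp only [Fin.succ_ne_zero, if_true, if_false, add_zero, ih]
    cases j with
    | zero => 
      cases m <;> simp
    | succ j => simp [ih, Nat.stirlingFirst_succ_succ, add_comm]

theorem bpass_ne_nil (l : List ℕ) (h : l ≠ []) : bpass l ≠ [] := by
  match l, h with
  | [a], _ => simp [bpass]
  | a :: b :: l, _ => rw [bpass]; split_ifs <;> simp

theorem bpass_perm (l : List ℕ) : (bpass l).Perm l := by
  match l with
  | [] => simp [bpass]
  | [a] => simp [bpass]
  | a :: b :: l =>
    rw [bpass]
    split_ifs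
    · exact ((bpass_perm (a :: l)).cons b).trans (List.Perm.swap a b l)
    · exact (bpass_perm (b :: l)).cons a
termination_by l.length

theorem bpass_snoc (l s : List ℕ) (m x : ℕ) (h : bpass l = s ++ [m]) :
    bpass (l ++ [x]) = if x < m then s ++ [x, m] else s ++ [m, x] := by
  match l, h with
  | [], h => simp [bpass] at h
  | [a], h =>
    have h' : [] ++ [a] = s ++ [m] := by simpa [bpass] using h
    obtain ⟨rfl, h2⟩ := List.append_inj' h' rfl
    obtain rfl : a = m := by simpa using h2
    simp [bpass]
  | a :: b :: l, h =>
    rw [bpass] at h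
    simp only [List.cons_append]
    rw [bpass]
    split_ifs at h ⊢ with h1 h2 h2
    all_goals
      cases s with
      | nil =>
        exfalso
        simp at h
        exact bpass_ne_nil _ (by simp) h.2
      | cons y s =>
        simp only [List.cons_append, List.cons.injEq] at h
        have := bpass_snoc _ s m x h.2
        simp [h2] at this
        simp [this, h.1]
termination_by l.length

/-- number of right-to-left maxima -/
def rmx : List ℕ → ℕ
  | [] => 0
  | x :: l => rmx l + if ∀ y ∈ l, y < x then 1 else 0

theorem pre_snoc (s : List ℕ) (c a : ℕ) :
    {τ | bpass τ = s ++ [c] ++ [a]} =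
      {τ | c < a ∧ ∃ ρ, bpass ρ = s ++ [a] ∧ ρ ++ [c] = τ} ∪
      {τ | c ≤ a ∧ ∃ ρ, bpass ρ = s ++ [c] ∧ ρ ++ [a] = τ} := by
  ext τ
  simp only [Set.mem_ofPred_eq, Set.mem_union]
  constructor
  · intro h
    rcases List.eq_nil_or_concat τ with rfl | ⟨ρ, x, rfl⟩
    · simp [bpass] at h
    rcases List.eq_nil_or_concat (bpass ρ) with h0 | ⟨s', m, h0⟩
    · have : ρ = [] := by
        by_contra hne
        exact bpass_ne_nil _ hne h0
      subst this
      simp [bpass] at h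
      have := congrArg List.length h
      simp at this
    · rw [List.concat_eq_append] at *
      rw [bpass_snoc ρ s' m x h0] at h
      split_ifs at h with hx
      · have h' : s' ++ [x, m] = s ++ [c, a] := by simpa using h
        obtain ⟨rfl, h2⟩ := List.append_inj' h' rfl
        simp at h2
        obtain ⟨rfl, rfl⟩ := h2
        exact Or.inl ⟨hx, ρ, h0, rfl⟩
      · have h' : s' ++ [m, x] = s ++ [c, a] := by simpa using h
        obtain ⟨rfl, h2⟩ := List.append_inj' h' rfl
        simp at h2
        obtain ⟨rfl, rfl⟩ := h2
        exact Or.inr ⟨by omega, ρ, h0, rfl⟩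
  · rintro (⟨h, ρ, h0, rfl⟩ | ⟨h, ρ, h0, rfl⟩)
    · rw [bpass_snoc ρ _ _ _ h0]; simp [h]
    · rw [bpass_snoc ρ _ _ _ h0]; simp [h]

theorem pre_single (a : ℕ) : {τ | bpass τ = [a]} = {[a]} := by
  ext τ
  simp only [Set.mem_ofPred_eq, Set.mem_singleton_iff]
  constructor
  · intro h
    have := bpass_perm τ
    rw [h] at this
    exact List.perm_singleton.1 this.symm
  · rintro rfl; simp [bpass]

theorem pre_count (t : List ℕ) : ∀ a, (a :: t).Nodup →
    {τ | bpass τ = t.reverse ++ [a]}.Finite ∧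
    {τ | bpass τ = t.reverse ++ [a]}.ncard = if ∀ y ∈ t, y < a then 2 ^ rmx t else 0 := by
  induction t with
  | nil => intro a _; simp [pre_single, rmx]
  | cons c t ih =>
    intro a hnd
    rw [List.reverse_cons, pre_snoc]
    have hca : c ≠ a := by rintro rfl; simp at hnd
    have h1 := ih a (by simp at hnd ⊢; tauto)
    have h2 := ih c (by simp at hnd ⊢; tauto)
    rcases lt_or_gt_of_ne hca with h | h
    · have e1 : {τ | c < a ∧ ∃ ρ, bpass ρ = t.reverse ++ [a] ∧ ρ ++ [c] = τ} =
        (fun ρ => ρ ++ [c]) '' {τ | bpass τ = t.reverse ++ [a]} := by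
        ext; simp [h]
      have e2 : {τ | c ≤ a ∧ ∃ ρ, bpass ρ = t.reverse ++ [c] ∧ ρ ++ [a] = τ} =
        (fun ρ => ρ ++ [a]) '' {τ | bpass τ = t.reverse ++ [c]} := by
        ext; simp [h.le]
      rw [e1, e2]
      refine ⟨(h1.1.image _).union (h2.1.image _), ?_⟩
      rw [Set.ncard_union_eq _ (h1.1.image _) (h2.1.image _),
        Set.ncard_image_of_injective _ (List.append_left_injective _),
        Set.ncard_image_of_injective _ (List.append_left_injective _), h1.2, h2.2]
      · have hl : (∀ y ∈ c :: t, y < a) ↔ ∀ y ∈ t, y < a := by simp [h]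
        simp only [hl]
        by_cases hc : ∀ y ∈ t, y < c
        · have ha : ∀ y ∈ t, y < a := fun y hy => (hc y hy).trans h
          rw [if_pos ha, if_pos hc, if_pos ha, rmx, if_pos hc]; ring
        · rw [if_neg hc, rmx, if_neg hc]; simp
      · rw [Set.disjoint_left]
        rintro _ ⟨x, _, rfl⟩ ⟨y, _, hy⟩
        have := (List.append_inj' hy rfl).2
        simp at this
        exact hca this.symm
    · have e : ¬ ∀ y ∈ c :: t, y < a := by
        simp; intro hh; omega
      rw [if_neg e]
      have e1 : ¬ c < a := by omega
      have e2 : ¬ c ≤ a := by omega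
      simp [e1, e2]

/-- all arrangements of `S`, with fuel -/
def arr : ℕ → Finset ℕ → Finset (List ℕ)
  | 0, _ => {[]}
  | m + 1, S => S.biUnion fun x => (arr m (S.erase x)).image (List.cons x)

theorem mem_arr (m : ℕ) : ∀ (S : Finset ℕ), S.card = m → ∀ l : List ℕ,
    l ∈ arr m S ↔ l.Nodup ∧ l.toFinset = S := by
  induction m with
  | zero =>
    intro S hS l
    rw [Finset.card_eq_zero] at hS
    subst hS
    simp [arr]
    rintro rfl; simp
  | succ m ih =>
    intro S hS l
    simp only [arr, Finset.mem_biUnion, Finset.mem_image]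
    constructor
    · rintro ⟨x, hx, t, ht, rfl⟩
      rw [ih _ (by rw [Finset.card_erase_of_mem hx]; omega)] at ht
      have hxt : x ∉ t := by
        rw [← List.mem_toFinset, ht.2]; simp
      refine ⟨List.nodup_cons.2 ⟨hxt, ht.1⟩, ?_⟩
      rw [List.toFinset_cons, ht.2, Finset.insert_erase hx]
    · rintro ⟨hn, hl⟩
      cases l with
      | nil => simp at hl; subst hl; simp at hS
      | cons x t =>
        have hx : x ∈ S := by rw [← hl]; simp
        refine ⟨x, hx, t, ?_, rfl⟩
        rw [ih _ (by rw [Finset.card_erase_of_mem hx]; omega)]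
        rw [List.nodup_cons] at hn
        refine ⟨hn.2, ?_⟩
        rw [← hl, List.toFinset_cons, Finset.erase_insert (by simpa using hn.1)]

theorem card_arr (m : ℕ) : ∀ (S : Finset ℕ), S.card = m → ∀ j : ℕ,
    ((arr m S).filter fun l => rmx l = j).card = Nat.stirlingFirst m j := by
  induction m with
  | zero =>
    intro S hS j
    cases j <;> simp [arr, rmx, Finset.filter_singleton]
  | succ m ih =>
    intro S hS j
    have hne : S.Nonempty := by rw [← Finset.card_pos]; omega
    set M := S.max' hne with hM
    have hMS : M ∈ S := S.max'_mem hne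
    have key : ((arr (m + 1) S).filter fun l => rmx l = j).card =
        ∑ x ∈ S, ((arr m (S.erase x)).filter fun l => rmx l + (if x = M then 1 else 0) = j).card := by
      rw [arr, Finset.filter_biUnion, Finset.card_biUnion]
      · refine Finset.sum_congr rfl fun x hx => ?_
        rw [Finset.filter_image, Finset.card_image_of_injective _ (List.cons_injective)]
        congr 1
        refine Finset.filter_congr fun l hl => ?_
        rw [mem_arr _ _ (by rw [Finset.card_erase_of_mem hx]; omega)] at hl
        have : (∀ y ∈ l, y < x) ↔ x = M := by
          have hmem : ∀ y, y ∈ l ↔ y ≠ x ∧ y ∈ S := by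
            intro y; rw [← List.mem_toFinset, hl.2, Finset.mem_erase]
          constructor
          · intro h
            by_contra hxM
            have h1 := h M ((hmem M).2 ⟨Ne.symm hxM, hMS⟩)
            have h2 := S.le_max' x hx
            omega
          · intro h y hy
            have h2 := S.le_max' y ((hmem y).1 hy).2
            have h3 := ((hmem y).1 hy).1
            omega
        simp only [rmx, this]
      · intro x _ y _ hxy
        rw [Function.onFun, Finset.disjoint_left]
        intro l h1 h2
        simp only [Finset.mem_filter, Finset.mem_image] at h1 h2
        obtain ⟨⟨a, _, rfl⟩, _⟩ := h1
        obtain ⟨⟨b, _, hb⟩, _⟩ := h2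
        simp at hb
        exact hxy hb.1.symm
    rw [key, ← Finset.add_sum_erase _ _ hMS]
    have e : ∀ x ∈ S.erase M, ((arr m (S.erase x)).filter fun l =>
        rmx l + (if x = M then 1 else 0) = j).card = Nat.stirlingFirst m j := by
      intro x hx
      rw [Finset.mem_erase] at hx
      simp only [if_neg hx.1, add_zero]
      exact ih _ (by rw [Finset.card_erase_of_mem hx.2]; omega) j
    have hcM : (S.erase M).card = m := by rw [Finset.card_erase_of_mem hMS]; omega
    rw [Finset.sum_congr rfl e, Finset.sum_const, hcM]
    simp only [if_true]
    cases j with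
    | zero => cases m <;> simp
    | succ j => simp [ih _ hcM, Nat.stirlingFirst_succ_succ, add_comm]

theorem isPermList_iff (n : ℕ) (l : List ℕ) :
    IsPermList n l ↔ l.Nodup ∧ l.toFinset = Finset.Icc 1 n := by
  have hnd : (idList n).Nodup := (List.nodup_range).map (add_left_injective 1)
  have hmem : ∀ a, a ∈ idList n ↔ a ∈ Finset.Icc 1 n := by
    intro a
    simp only [idList, List.mem_map, List.mem_range, Finset.mem_Icc]
    constructor
    · rintro ⟨b, hb, rfl⟩; omega
    · intro h; exact ⟨a - 1, by omega, by omega⟩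
  unfold IsPermList
  constructor
  · intro h
    refine ⟨h.nodup_iff.2 hnd, ?_⟩
    ext a
    rw [List.mem_toFinset, h.mem_iff, hmem]
  · rintro ⟨h1, h2⟩
    rw [List.perm_ext_iff_of_nodup h1 hnd]
    intro a
    rw [hmem, ← h2, List.mem_toFinset]

theorem pre_eq (n : ℕ) (σ : List ℕ) (h : IsPermList n σ) :
    {τ : List ℕ | IsPermList n τ ∧ bpass τ = σ} = {τ | bpass τ = σ} := by
  ext τ
  simp only [Set.mem_ofPred_eq, and_iff_right_iff_imp]
  rintro rfl
  exact (bpass_perm τ).symm.trans h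

theorem good_set (m j : ℕ) :
    {σ : List ℕ | IsPermList (m + 1) σ ∧
        Set.ncard {τ : List ℕ | IsPermList (m + 1) τ ∧ bpass τ = σ} = 2 ^ j} =
      (fun t : List ℕ => t.reverse ++ [m + 1]) ''
        (((arr m (Finset.Icc 1 m)).filter fun l => rmx l = j : Finset (List ℕ)) : Set (List ℕ)) := by
  ext σ
  simp only [Set.mem_ofPred_eq, Set.mem_image, Finset.coe_filter, mem_arr m (Finset.Icc 1 m) (by simp)]
  have hI : Finset.Icc 1 (m + 1) = insert (m + 1) (Finset.Icc 1 m) := by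
    ext a; simp; omega
  constructor
  · rintro ⟨hp, hc⟩
    rw [pre_eq _ _ hp] at hc
    have hp' := (isPermList_iff _ _).1 hp
    rcases List.eq_nil_or_concat σ with rfl | ⟨s, a, rfl⟩
    · have := hp'.2; rw [hI] at this; simp at this; exact absurd this.symm (Finset.insert_ne_empty _ _)
    rw [List.concat_eq_append] at *
    obtain ⟨t, rfl⟩ : ∃ t : List ℕ, t.reverse = s := ⟨s.reverse, by simp⟩
    have hnd : (a :: t).Nodup := by
      have := List.nodup_reverse.2 hp'.1
      simpa using this
    rw [(pre_count t a hnd).2] at hc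
    have hmem : ∀ y, y ∈ a :: t ↔ 1 ≤ y ∧ y ≤ m + 1 := by
      intro y
      rw [← Finset.mem_Icc, ← hp'.2]; simp [or_comm]
    split_ifs at hc with hlt
    · have ha : a = m + 1 := by
        have h1 := (hmem (m + 1)).2 (by omega)
        have h2 := (hmem a).1 (by simp)
        rcases List.mem_cons.1 h1 with h | h
        · exact h.symm
        · have := hlt _ h; omega
      subst ha
      rw [List.nodup_cons] at hnd
      refine ⟨t, ⟨⟨hnd.2, ?_⟩, Nat.pow_right_injective le_rfl hc⟩, rfl⟩
      ext y
      rw [List.mem_toFinset, Finset.mem_Icc]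
      constructor
      · intro hy
        have := (hmem y).1 (by simp [hy])
        have := hlt y hy
        omega
      · intro hy
        have := (hmem y).2 (by omega)
        rcases List.mem_cons.1 this with h | h
        · omega
        · exact h
    · exact absurd hc.symm (by positivity)
  · rintro ⟨t, ⟨⟨h1, h2⟩, h3⟩, rfl⟩
    have hmem : ∀ y, y ∈ t ↔ 1 ≤ y ∧ y ≤ m := by
      intro y; rw [← Finset.mem_Icc, ← h2, List.mem_toFinset]
    have hnot : m + 1 ∉ t := by rw [hmem]; omega
    have hnd : ((m + 1) :: t).Nodup := List.nodup_cons.2 ⟨hnot, h1⟩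
    have hp : IsPermList (m + 1) (t.reverse ++ [m + 1]) := by
      rw [isPermList_iff]
      constructor
      · rw [← List.reverse_cons, List.nodup_reverse]; exact hnd
      · rw [← List.reverse_cons, List.toFinset_reverse, List.toFinset_cons, h2, hI]
    refine ⟨hp, ?_⟩
    rw [pre_eq _ _ hp, (pre_count t _ hnd).2, if_pos, h3]
    intro y hy
    have := (hmem y).1 hy
    omega

/-- The number of permutations of size `n` with exactly `2^(k-1)` bubblesort preimages
equals the unsigned Stirling number of the first kind `[n-1, k-1]`, i.e. the number of
permutations of `n-1` elements with `k-1` cycles. -/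
theorem stmt_7 (n k : ℕ) (hn : 1 ≤ n) (hk : 1 ≤ k) :
    Set.ncard {σ : List ℕ | IsPermList n σ ∧
        Set.ncard {τ : List ℕ | IsPermList n τ ∧ bpass τ = σ} = 2 ^ (k - 1)} =
      Nat.card {g : Equiv.Perm (Fin (n - 1)) // cycleCount g = k - 1} := by
  obtain ⟨m, rfl⟩ : ∃ m, n = m + 1 := ⟨n - 1, by omega⟩
  rw [good_set, Set.ncard_image_of_injective, Set.ncard_coe_finset, card_arr m _ (by simp)]
  · rw [Nat.card_eq_fintype_card, Fintype.card_subtype]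
    exact (card_cycleCount m (k - 1)).symm
  · intro a b h
    simpa using h
end

section
/- For every permutation π of size n with π ≠ id_n, there exists a permutation τ of size n with B(τ) = id_n and τ ≠ id_n such that the trees of iterated bubblesort preimages T(π) and T(τ) are isomorphic as rooted trees. -/
/-- Inversion code relative to a list of already seen entries. -/
def cAux : List ℕ → List ℕ → List ℕ
  | _, [] => []
  | S, a :: l => S.countP (fun x => decide (a < x)) :: cAux (a :: S) l

theorem cAux_perm (l : List ℕ) : ∀ S S' : List ℕ, S.Perm S' → cAux S l = cAux S' l := by
  induction l with
  | nil => intro S S' h; rfl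
  | cons a l ih =>
    intro S S' h
    simp only [cAux]
    rw [h.countP_eq, ih _ _ (h.cons a)]

theorem cAux_length (l : List ℕ) : ∀ S : List ℕ, (cAux S l).length = l.length := by
  induction l with
  | nil => intro S; rfl
  | cons a l ih => intro S; simp [cAux, ih]

theorem cAux_append (l : List ℕ) (a : ℕ) : ∀ S : List ℕ,
    cAux S (l ++ [a]) = cAux S l ++ [(S ++ l).countP (fun x => decide (a < x))] := by
  induction l with
  | nil => intro S; simp [cAux]
  | cons b l ih =>
    intro S
    simp only [List.cons_append, cAux, ih]
    congr 3
    exact (List.perm_middle (a := b) (l₁ := S) (l₂ := l)).symm.countP_eq _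

theorem cAux_bpass (l : List ℕ) : ∀ (m : ℕ) (S : List ℕ), (∀ x ∈ S, x ≤ m) →
    cAux S (bpass (m :: l)) = (cAux (m :: S) l).map (· - 1) ++ [0] := by
  induction l with
  | nil =>
    intro m S h
    simpa [bpass, cAux, List.countP_eq_zero] using h
  | cons b l ih =>
    intro m S h
    rw [bpass]
    split_ifs with hb
    · simp only [cAux, List.map_cons, List.cons_append]
      rw [ih m (b :: S) (by intro x hx; rcases List.mem_cons.1 hx with rfl | hx
                            · omega
                            · exact h x hx)]
      rw [cAux_perm l _ _ (List.Perm.swap b m S)]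
      simp [hb]
    · simp only [cAux, List.map_cons, List.cons_append]
      rw [ih b (m :: S) (by intro x hx; rcases List.mem_cons.1 hx with rfl | hx
                            · omega
                            · have := h x hx; omega)]
      have h1 : S.countP (fun x => decide (m < x)) = 0 := by
        simpa [List.countP_eq_zero] using h
      have h2 : S.countP (fun x => decide (b < x)) = 0 := by
        rw [List.countP_eq_zero]
        intro x hx
        have := h x hx
        simp; omega
      simp [h1, h2, hb]

/-- Inversion code as a function. -/
def cf (l : List ℕ) (i : ℕ) : ℕ := (cAux [] l).getD i 0

theorem cf_bpass (l : List ℕ) (i : ℕ) : cf (bpass l) i = cf l (i + 1) - 1 := by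
  cases l with
  | nil => simp [cf, bpass, cAux]
  | cons a l =>
    unfold cf
    rw [cAux_bpass l a [] (by simp)]
    simp only [cAux, List.getD_cons_succ]
    generalize cAux [a] l = e
    induction e generalizing i with
    | nil => cases i <;> simp
    | cons x e ih => cases i with
      | zero => simp
      | succ i => simpa using ih i

theorem cf_iter (j : ℕ) : ∀ (l : List ℕ) (i : ℕ), cf (bpass^[j] l) i = cf l (i + j) - j := by
  induction j with
  | zero => intro l i; simp
  | succ j ih =>
    intro l i
    rw [Function.iterate_succ_apply, ih, cf_bpass]
    rw [show i + (j + 1) = i + j + 1 by omega]; omega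

theorem iter_perm (j : ℕ) : ∀ l : List ℕ, (bpass^[j] l).Perm l := by
  induction j with
  | zero => intro l; simp
  | succ j ih => intro l; rw [Function.iterate_succ_apply]; exact (ih _).trans (bpass_perm l)

theorem idList_succ (n : ℕ) : idList (n + 1) = idList n ++ [n + 1] := by
  simp [idList, List.range_succ]

theorem idList_length (n : ℕ) : (idList n).length = n := by simp [idList]

theorem idList_nodup (n : ℕ) : (idList n).Nodup := by
  unfold idList
  exact List.nodup_range.map (fun a b h => by simpa using h)

theorem cf_of_ge (l : List ℕ) (i : ℕ) (h : l.length ≤ i) : cf l i = 0 := by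
  unfold cf
  rw [List.getD_eq_default]
  rw [cAux_length]; exact h

theorem cf_append_lt (l : List ℕ) (a i : ℕ) (h : i < l.length) : cf (l ++ [a]) i = cf l i := by
  unfold cf
  rw [cAux_append, List.getD_append]
  rw [cAux_length]; exact h

theorem cf_append_eq (l : List ℕ) (a : ℕ) :
    cf (l ++ [a]) l.length = l.countP (fun x => decide (a < x)) := by
  unfold cf
  rw [cAux_append, List.getD_append_right _ _ _ _ (by rw [cAux_length])]
  simp [cAux_length]

theorem cf_le (l : List ℕ) : ∀ i, cf l i ≤ i := by
  induction l using List.reverseRecOn with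
  | nil => intro i; simp [cf, cAux]
  | append_singleton l a ih =>
    intro i
    rcases lt_trichotomy i l.length with h | h | h
    · rw [cf_append_lt _ _ _ h]; exact ih i
    · subst h; rw [cf_append_eq]; exact List.countP_le_length
    · rw [cf_of_ge]
      · omega
      · simp; omega

theorem cf_id (n i : ℕ) : cf (idList n) i = 0 := by
  induction n with
  | zero => simp [cf, idList, cAux]
  | succ n ih =>
    rw [idList_succ]
    rcases lt_trichotomy i n with h | h | h
    · rw [cf_append_lt _ _ _ (by rw [idList_length]; exact h)]; exact ih
    · have := cf_append_eq (idList n) (n + 1)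
      rw [idList_length] at this
      rw [h, this, List.countP_eq_zero]
      intro x hx
      simp [idList] at hx
      simp; omega
    · apply cf_of_ge
      simp [idList_length]; omega

theorem countP_anti (s : List ℕ) (a b : ℕ) (hb : b ∈ s) (h : a < b) :
    s.countP (fun x => decide (b < x)) < s.countP (fun x => decide (a < x)) := by
  induction s with
  | nil => simp at hb
  | cons y s ih =>
    have hmono : s.countP (fun x => decide (b < x)) ≤ s.countP (fun x => decide (a < x)) := by
      apply List.countP_mono_left
      intro x _ hx
      simp at hx ⊢; omega
    simp only [List.countP_cons]
    rcases List.mem_cons.1 hb with rfl | hb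
    · simp [h]; omega
    · have := ih hb
      by_cases h1 : b < y
      · have h2 : a < y := by omega
        simp [h1, h2]; exact this
      · simp only [h1, decide_false]
        simp only [Bool.false_eq_true, if_false]
        omega

theorem cf_inj (l : List ℕ) : ∀ l' : List ℕ, l.Perm l' → (∀ i, cf l i = cf l' i) → l = l' := by
  induction l using List.reverseRecOn with
  | nil => intro l' h _; simpa using h.nil_eq
  | append_singleton l a ih =>
    intro l' hp hc
    rcases List.eq_nil_or_concat l' with rfl | ⟨m, b, rfl⟩
    · simp at hp
    · rw [List.concat_eq_append] at *
      have hlen : l.length = m.length := by simpa using hp.length_eq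
      have h1 := cf_append_eq l a
      have h2 := cf_append_eq m b
      rw [hc, hlen, h2] at h1
      have e1 : (l ++ [a]).countP (fun x => decide (a < x)) = l.countP (fun x => decide (a < x)) := by
        simp
      have e2 : (m ++ [b]).countP (fun x => decide (b < x)) = m.countP (fun x => decide (b < x)) := by
        simp
      rw [← e1, ← e2, ← hp.countP_eq] at h1
      have hab : a = b := by
        rcases lt_trichotomy a b with h | h | h
        · have := countP_anti (l ++ [a]) a b (hp.mem_iff.2 (by simp)) h; omega
        · exact h
        · have := countP_anti (l ++ [a]) b a (by simp) h; omega
      subst hab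
      congr 1
      apply ih m ((List.perm_append_right_iff [a]).1 hp)
      intro i
      by_cases hi : i < l.length
      · have := hc i
        rwa [cf_append_lt _ _ _ hi, cf_append_lt _ _ _ (hlen ▸ hi)] at this
      · rw [cf_of_ge _ _ (by omega), cf_of_ge _ _ (by omega)]

theorem exists_rank (s : List ℕ) (hs : s.Nodup) (k : ℕ) (hk : k < s.length) :
    ∃ a ∈ s, s.countP (fun x => decide (a < x)) = k := by
  have hinj : Set.InjOn (fun a => s.countP (fun x => decide (a < x))) (s.toFinset : Set ℕ) := by
    intro a ha b hb h
    simp only [List.coe_toFinset, Set.mem_ofPred_eq] at ha hb h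
    rcases lt_trichotomy a b with h' | h' | h'
    · have := countP_anti s a b hb h'; omega
    · exact h'
    · have := countP_anti s b a ha h'; omega
  have himg : s.toFinset.image (fun a => s.countP (fun x => decide (a < x)))
      = Finset.range s.length := by
    apply Finset.eq_of_subset_of_card_le
    · intro y hy
      simp only [Finset.mem_image, List.mem_toFinset] at hy
      obtain ⟨a, ha, rfl⟩ := hy
      rw [Finset.mem_range]
      refine lt_of_le_of_ne List.countP_le_length ?_
      intro h
      rw [List.countP_eq_length] at h
      simpa using h a ha
    · rw [Finset.card_image_of_injOn hinj, Finset.card_range, List.toFinset_card_of_nodup hs]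
  have : k ∈ s.toFinset.image (fun a => s.countP (fun x => decide (a < x))) := by
    rw [himg]; simpa using hk
  simpa using this

theorem cf_surj (n : ℕ) : ∀ (s : List ℕ), s.Nodup → s.length = n → ∀ g : ℕ → ℕ,
    (∀ i, g i ≤ i) → (∀ i, n ≤ i → g i = 0) → ∃ l : List ℕ, l.Perm s ∧ ∀ i, cf l i = g i := by
  induction n with
  | zero =>
    intro s _ hs g _ hg
    refine ⟨s, List.Perm.refl _, fun i => ?_⟩
    rw [cf_of_ge _ _ (by omega), hg _ (by omega)]
  | succ n ih =>
    intro s hnd hs g hle hg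
    obtain ⟨a, ha, hc⟩ := exists_rank s hnd (g n) (by have := hle n; omega)
    have hlen : (s.erase a).length = n := by rw [List.length_erase_of_mem ha]; omega
    obtain ⟨l, hl, hlc⟩ := ih (s.erase a) (hnd.erase a) hlen
      (fun i => if i < n then g i else 0)
      (by intro i; have := hle i; split_ifs <;> omega)
      (by intro i hi; rw [if_neg (by omega)])
    have hp : (l ++ [a]).Perm s :=
      (List.perm_append_singleton a l).trans ((hl.cons a).trans (List.perm_cons_erase ha).symm)
    have hll : l.length = n := by rw [hl.length_eq, hlen]
    refine ⟨l ++ [a], hp, fun i => ?_⟩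
    rcases lt_trichotomy i n with h | h | h
    · rw [cf_append_lt _ _ _ (by omega), hlc, if_pos h]
    · have h1 := cf_append_eq l a
      rw [hll] at h1
      rw [h, h1, ← hc, ← hp.countP_eq]
      simp
    · rw [cf_of_ge _ _ (by simp; omega), hg _ (by omega)]

theorem perm_ext {n : ℕ} {l l' : List ℕ} (h : IsPermList n l) (h' : IsPermList n l')
    (hc : ∀ i, cf l i = cf l' i) : l = l' :=
  cf_inj l l' (h.trans h'.symm) hc

theorem cf_zero_of_ge {n : ℕ} {l : List ℕ} (h : IsPermList n l) (i : ℕ) (hi : n ≤ i) :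
    cf l i = 0 := by
  apply cf_of_ge
  rw [h.length_eq, idList_length]; exact hi

theorem perm_exists (n : ℕ) (g : ℕ → ℕ) (h1 : ∀ i, g i ≤ i) (h2 : ∀ i, n ≤ i → g i = 0) :
    ∃ l, IsPermList n l ∧ ∀ i, cf l i = g i :=
  cf_surj n (idList n) (idList_nodup n) (idList_length n) g h1 h2

theorem depth_aux {n : ℕ} {π σ : List ℕ} (hπ : IsPermList n π) (hne : π ≠ idList n) {j j' : ℕ}
    (h : bpass^[j] σ = π) (h' : bpass^[j'] σ = π) : ¬ j < j' := by
  intro hlt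
  apply hne
  obtain ⟨d, rfl⟩ : ∃ d, j' = d + j := ⟨j' - j, by omega⟩
  rw [Function.iterate_add_apply, h] at h'
  have hfix : (bpass^[d])^[n] π = π := Function.iterate_fixed h' n
  rw [← Function.iterate_mul] at hfix
  apply perm_ext hπ (List.Perm.refl _)
  intro i
  rw [cf_id, ← hfix, cf_iter, cf_zero_of_ge hπ]
  · omega
  · have : n ≤ d * n := Nat.le_mul_of_pos_left n (by omega)
    omega

theorem depth_unique {n : ℕ} {π σ : List ℕ} (hπ : IsPermList n π) (hne : π ≠ idList n) {j j' : ℕ}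
    (h : bpass^[j] σ = π) (h' : bpass^[j'] σ = π) : j = j' := by
  have := depth_aux hπ hne h h'
  have := depth_aux hπ hne h' h
  omega

theorem stmt_10 (n : ℕ) (π : List ℕ) (hπ : IsPermList n π) (hne : π ≠ idList n) :
    ∃ τ, IsPermList n τ ∧ bpass τ = idList n ∧ τ ≠ idList n ∧ TreeIso n π τ := by
  classical
  obtain ⟨τ, hτ, hτc⟩ := perm_exists n (fun i => min (cf π i) 1)
    (fun i => (min_le_left _ _).trans (cf_le π i))
    (fun i hi => by simp [cf_zero_of_ge hπ i hi])
  have hτne : τ ≠ idList n := by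
    intro h
    apply hne
    apply perm_ext hπ (List.Perm.refl _)
    intro i
    have := hτc i
    rw [h, cf_id] at this
    rw [cf_id]; omega
  have hb : bpass τ = idList n := by
    apply perm_ext ((bpass_perm τ).trans hτ) (List.Perm.refl _)
    intro i
    rw [cf_bpass, hτc, cf_id]; omega
  refine ⟨τ, hτ, hb, hτne, ?_⟩
  have key : ∀ σ, ∃ ρ, ∀ j, IsPermList n σ → bpass^[j] σ = π → IsPermList n ρ ∧
      ∀ i, cf ρ i = cf σ i - (if j ≤ i then cf π (i - j) - 1 else 0) := by
    intro σ
    by_cases h : IsPermList n σ ∧ ∃ j, bpass^[j] σ = π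
    · obtain ⟨hσ, j, hj⟩ := h
      obtain ⟨ρ, h1, h2⟩ := perm_exists n
        (fun i => cf σ i - (if j ≤ i then cf π (i - j) - 1 else 0))
        (fun i => (Nat.sub_le _ _).trans (cf_le σ i))
        (fun i hi => by simp [cf_zero_of_ge hσ i hi])
      refine ⟨ρ, fun j' _ hj' => ?_⟩
      rw [← depth_unique hπ hne hj hj']
      exact ⟨h1, h2⟩
    · exact ⟨[], fun j h1 h2 => absurd ⟨h1, j, h2⟩ h⟩
  choose φ hφ using key
  have hdep : ∀ σ j, IsPermList n σ → bpass^[j] σ = π → bpass^[j] (φ σ) = τ := by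
    intro σ j h1 h2
    obtain ⟨h3, h4⟩ := hφ σ j h1 h2
    apply perm_ext ((iter_perm j _).trans h3) hτ
    intro i
    have h5 := cf_iter j σ i
    rw [h2] at h5
    rw [cf_iter, h4, hτc, if_pos (by omega), show i + j - j = i by omega]
    omega
  have hinj : ∀ σ σ', IsNode n π σ → IsNode n π σ' → φ σ = φ σ' → σ = σ' := by
    rintro σ σ' ⟨h1, j, hj⟩ ⟨h1', j', hj'⟩ he
    have e1 := hdep σ j h1 hj
    have e2 := hdep σ' j' h1' hj'
    rw [← he] at e2
    obtain rfl := depth_unique hτ hτne e1 e2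
    apply perm_ext h1 h1'
    intro i
    have a1 := (hφ σ j h1 hj).2 i
    have a2 := (hφ σ' j h1' hj').2 i
    rw [← he, a1] at a2
    split_ifs at a2 with hi
    · have b1 := cf_iter j σ (i - j)
      have b2 := cf_iter j σ' (i - j)
      rw [hj, show i - j + j = i by omega] at b1
      rw [hj', show i - j + j = i by omega] at b2
      omega
    · simpa using a2
  refine ⟨φ, ?_, hinj, ?_, ?_, ?_⟩
  · rintro σ ⟨h1, j, hj⟩
    exact ⟨(hφ σ j h1 hj).1, j, hdep σ j h1 hj⟩
  · rintro ρ ⟨h1, j, hj⟩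
    have hρ : ∀ i, j ≤ i → cf ρ i - j = min (cf π (i - j)) 1 := by
      intro i hi
      have := cf_iter j ρ (i - j)
      rw [hj, hτc, show i - j + j = i by omega] at this
      exact this.symm
    obtain ⟨σ, h2, h3⟩ := perm_exists n
      (fun i => cf ρ i + (if j ≤ i then cf π (i - j) - 1 else 0))
      (fun i => by
        have := cf_le ρ i
        split_ifs with hi
        · have := hρ i hi
          have := cf_le π (i - j)
          omega
        · omega)
      (fun i hi => by
        have := cf_zero_of_ge h1 i hi
        split_ifs with hi
        · have := hρ i hi
          omega
        · omega)
    have h4 : bpass^[j] σ = π := by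
      apply perm_ext ((iter_perm j _).trans h2) hπ
      intro i
      have := hρ (i + j) (by omega)
      rw [show i + j - j = i by omega] at this
      rw [cf_iter, h3, if_pos (by omega), show i + j - j = i by omega]
      omega
    refine ⟨σ, ⟨h2, j, h4⟩, ?_⟩
    obtain ⟨h5, h6⟩ := hφ σ j h2 h4
    apply perm_ext h5 h1
    intro i
    rw [h6, h3]
    omega
  · exact hdep π 0 hπ rfl
  · rintro σ ⟨h1, j, hj⟩ hs
    cases j with
    | zero => exact absurd hj hs
    | succ j =>
      obtain ⟨a1, a2⟩ := hφ σ (j + 1) h1 hj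
      rw [Function.iterate_succ_apply] at hj
      obtain ⟨b1, b2⟩ := hφ (bpass σ) j ((bpass_perm σ).trans h1) hj
      apply perm_ext b1 ((bpass_perm _).trans a1)
      intro i
      rw [b2, cf_bpass, cf_bpass, a2, show i + 1 - (j + 1) = i - j by omega]
      simp only [Nat.add_le_add_iff_right]
      omega
end

section
/- For every node π ≠ id_n of the tree T_n of iterated bubblesort preimages with at least one child, either all of the children of π are leaves, or exactly half of them are leaves. More precisely, if π has k left-to-right maxima and πₙ = n, then π has 2^(k−1) children of which exactly 2^(k−2) are leaves when the longest suffix of left-to-right maxima of π has length ≥ 2 (and all 2^(k−1) children are leaves when the suffix has length 1). -/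
theorem bpass_last (l : List ℕ) (h : l ≠ []) :
    ∃ l0 M, bpass l = l0 ++ [M] ∧ ∀ x ∈ l, x ≤ M := by
  fun_induction bpass l with
  | case1 => simp at h
  | case2 a => exact ⟨[], a, by simp, by simp⟩
  | case3 a b l h ih =>
    obtain ⟨l0, M, h1, h2⟩ := ih (by simp)
    refine ⟨b :: l0, M, by simp [h1], ?_⟩
    have := h2 a (by simp)
    intro x hx
    simp only [List.mem_cons] at hx h2
    rcases hx with rfl | rfl | hx
    · exact this
    · omega
    · exact h2 x (Or.inr hx)
  | case4 a b l h ih =>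
    obtain ⟨l0, M, h1, h2⟩ := ih (by simp)
    refine ⟨a :: l0, M, by simp [h1], ?_⟩
    have := h2 b (by simp)
    intro x hx
    rcases List.mem_cons.1 hx with rfl | hx
    · omega
    · exact h2 x hx

theorem bpass_append (l : List ℕ) (M : ℕ) (h : ∀ x ∈ l, x ≤ M) :
    bpass (l ++ [M]) = bpass l ++ [M] := by
  fun_induction bpass l with
  | case1 => simp [bpass]
  | case2 a => 
    have := h a (by simp)
    simp [bpass, this]
  | case3 a b l hh ih =>
    have := ih (by intro x hx; apply h; simp at hx ⊢; tauto)
    simp only [List.cons_append] at this ⊢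
    simp [bpass, hh, this]
  | case4 a b l hh ih =>
    have := ih (by intro x hx; apply h; simp at hx ⊢; tauto)
    simp only [List.cons_append] at this ⊢
    simp [bpass, hh, this]

theorem bpass_fixed (l : List ℕ) (h : bpass l = l) : l.Pairwise (· ≤ ·) := by
  rw [← List.isChain_iff_pairwise]
  fun_induction bpass l with
  | case1 => simp
  | case2 a => simp
  | case3 a b l hh ih =>
    simp at h; omega
  | case4 a b l hh ih =>
    simp at h
    exact List.isChain_cons_cons.2 ⟨by omega, ih h⟩

theorem bpass_sorted (l : List ℕ) (h : l.Pairwise (· ≤ ·)) : bpass l = l := by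
  fun_induction bpass l with
  | case1 => simp
  | case2 a => simp
  | case3 a b l hh ih =>
    have := (List.pairwise_cons.1 h).1 b (by simp)
    omega
  | case4 a b l hh ih =>
    rw [ih (List.pairwise_cons.1 h).2]

theorem idList_sorted (n : ℕ) : (idList n).Pairwise (· ≤ ·) := by
  unfold idList
  rw [List.pairwise_map]
  exact List.pairwise_lt_range.imp (by intros; omega)

theorem mem_idList (n x : ℕ) : x ∈ idList n ↔ 1 ≤ x ∧ x ≤ n := by
  unfold idList
  simp only [List.mem_map, List.mem_range]
  constructor
  · rintro ⟨a, h, rfl⟩; omega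
  · intro h; exact ⟨x - 1, by omega, by omega⟩

/-- number of left-to-right maxima exceeding `c`. -/
def cnt (c : ℕ) : List ℕ → ℕ
  | [] => 0
  | a :: l => if c < a then 1 + cnt a l else cnt c l

theorem cnt_append (c : ℕ) (l : List ℕ) (a : ℕ) :
    cnt c (l ++ [a]) = cnt c l + if (c < a ∧ ∀ x ∈ l, x < a) then 1 else 0 := by
  induction l generalizing c with
  | nil => simp [cnt]
  | cons b l ih =>
    simp only [List.cons_append, cnt, ih, List.mem_cons, forall_eq_or_imp]
    split_ifs <;> first | omega | (exfalso; grind)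

theorem cnt_pos (c : ℕ) (l : List ℕ) (a : ℕ) (ha : a ∈ l) (hc : c < a) : 0 < cnt c l := by
  induction l generalizing c with
  | nil => simp at ha
  | cons b l ih =>
    simp only [cnt]
    split_ifs with h
    · omega
    · refine ih c ?_ hc
      rcases List.mem_cons.1 ha with rfl | h'
      · omega
      · exact h'

theorem isLTR_append (l : List ℕ) (a j : ℕ) (hj : j < l.length) :
    IsLTRMax (l ++ [a]) j ↔ IsLTRMax l j := by
  unfold IsLTRMax
  have h : ∀ i ≤ j, (l ++ [a]).getD i 0 = l.getD i 0 := by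
    intro i hi
    exact List.getD_append _ _ _ _ (by omega)
  constructor
  · rintro ⟨_, h2⟩
    refine ⟨hj, fun i hi => ?_⟩
    have := h2 i hi
    rwa [h i (by omega), h j (by omega)] at this
  · rintro ⟨_, h2⟩
    refine ⟨by simp; omega, fun i hi => ?_⟩
    rw [h i (by omega), h j (by omega)]
    exact h2 i hi

theorem isLTR_last (l : List ℕ) (a : ℕ) :
    IsLTRMax (l ++ [a]) l.length ↔ ∀ x ∈ l, x < a := by
  unfold IsLTRMax
  have h2 : (l ++ [a]).getD l.length 0 = a := by simp
  rw [h2]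
  constructor
  · rintro ⟨_, h⟩ x hx
    obtain ⟨i, hi, rfl⟩ := List.mem_iff_getElem.1 hx
    have := h i hi
    rw [List.getD_append _ _ _ _ hi] at this
    simpa [hi] using this
  · intro h
    refine ⟨by simp, fun i hi => ?_⟩
    rw [List.getD_append _ _ _ _ hi, List.getD_eq_getElem _ _ hi]
    exact h _ (List.getElem_mem hi)

theorem ltrCount_append (l : List ℕ) (a : ℕ) :
    ltrCount (l ++ [a]) = ltrCount l + if (∀ x ∈ l, x < a) then 1 else 0 := by
  unfold ltrCount
  rw [List.length_append, List.length_singleton, List.range_succ, List.filter_append,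
    List.length_append]
  congr 1
  · congr 1
    apply List.filter_congr
    intro j hj
    rw [List.mem_range] at hj
    simp only [isLTR_append l a j hj]
  · simp only [List.filter_singleton, isLTR_last]
    by_cases h : ∀ x ∈ l, x < a
    · rw [if_pos h, decide_eq_true h]; rfl
    · rw [if_neg h, decide_eq_false h]; rfl

theorem ltrCount_eq (l : List ℕ) (h : ∀ x ∈ l, 0 < x) : ltrCount l = cnt 0 l := by
  induction l using List.reverseRecOn with
  | nil => simp [ltrCount, cnt]
  | append_singleton l a ih =>
    rw [ltrCount_append, cnt_append, ih (fun x hx => h x (by simp [hx]))]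
    have : 0 < a := h a (by simp)
    simp [this]

theorem suffLen_append (l : List ℕ) (b a : ℕ) (hb : ∀ x ∈ l, x < a) (hba : b < a) :
    (2 ≤ suffLen (l ++ [b] ++ [a]) ↔ ∀ x ∈ l, x < b) ∧
    1 ≤ suffLen (l ++ [b] ++ [a]) := by
  have h1 : IsLTRMax (l ++ [b] ++ [a]) (l.length + 1) := by
    have := (isLTR_last (l ++ [b]) a).2 (by simp; grind)
    simpa using this
  have h2 : IsLTRMax (l ++ [b] ++ [a]) l.length ↔ ∀ x ∈ l, x < b := by
    rw [isLTR_append _ _ _ (by simp), isLTR_last]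
  unfold suffLen
  have hl : (l ++ [b] ++ [a]).length = l.length + 1 + 1 := by simp
  rw [hl, List.range_succ_eq_map, List.range_succ_eq_map]
  simp only [List.map_cons, List.takeWhile_cons, Nat.add_sub_cancel, Nat.sub_zero,
    Nat.succ_eq_add_one, Nat.zero_add, h1, h2, decide_true, if_true]
  split_ifs with h <;> simp_all

/-- preimages with head exceeding `c`. -/
def preS (c : ℕ) (l : List ℕ) : Set (List ℕ) :=
  {r | bpass r = l ∧ ∃ x t, r = x :: t ∧ c < x}

/-- insert in second place -/
def ins2 (c : ℕ) : List ℕ → List ℕ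
  | [] => []
  | x :: t => x :: c :: t

theorem ins2_inj (c : ℕ) : Function.Injective (ins2 c) := by
  intro a b h
  cases a <;> cases b <;> simp_all [ins2]

theorem bpass_ne (r : List ℕ) (h : r ≠ []) : bpass r ≠ [] := by
  intro h'
  have := bpass_perm r
  rw [h'] at this
  exact h this.symm.eq_nil

theorem preS_lt (c c' : ℕ) (l : List ℕ) (hl : l ≠ []) (h : c' < c) :
    preS c (c' :: l) = ins2 c' '' preS c l := by
  ext r
  simp only [preS, Set.mem_ofPred_eq, Set.mem_image]
  constructor
  · rintro ⟨hb, x, t, rfl, hx⟩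
    cases t with
    | nil => simp [bpass] at hb; exact absurd hb.2 hl
    | cons y t =>
      simp only [bpass] at hb
      split_ifs at hb with hyx
      · simp only [List.cons.injEq] at hb
        exact ⟨x :: t, ⟨hb.2, x, t, rfl, hx⟩, by simp [ins2, hb.1]⟩
      · simp only [List.cons.injEq] at hb
        omega
  · rintro ⟨_, ⟨hb, x, t, rfl, hx⟩, rfl⟩
    refine ⟨?_, x, c' :: t, rfl, hx⟩
    simp [ins2, bpass, show c' < x by omega, hb]

theorem preS_gt (c c' : ℕ) (l : List ℕ) (hl : l ≠ []) (h : c < c') (hc : c' ∉ l) :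
    preS c (c' :: l) = ins2 c' '' preS c' l ∪ (List.cons c') '' preS c' l := by
  ext r
  simp only [preS, Set.mem_ofPred_eq, Set.mem_image, Set.mem_union]
  constructor
  · rintro ⟨hb, x, t, rfl, hx⟩
    cases t with
    | nil => simp [bpass] at hb; exact absurd hb.2 hl
    | cons y t =>
      simp only [bpass] at hb
      split_ifs at hb with hyx
      · simp only [List.cons.injEq] at hb
        exact Or.inl ⟨x :: t, ⟨hb.2, x, t, rfl, by omega⟩, by simp [ins2, hb.1]⟩
      · simp only [List.cons.injEq] at hb
        refine Or.inr ⟨y :: t, ⟨hb.2, y, t, rfl, ?_⟩, by simp [hb.1]⟩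
        have hy : y ∈ l := by
          rw [← hb.2, (bpass_perm _).mem_iff]; simp
        have : y ≠ c' := by rintro rfl; exact hc hy
        omega
  · rintro (⟨_, ⟨hb, x, t, rfl, hx⟩, rfl⟩ | ⟨_, ⟨hb, x, t, rfl, hx⟩, rfl⟩)
    · refine ⟨?_, x, c' :: t, rfl, by omega⟩
      simp [ins2, bpass, hx, hb]
    · refine ⟨?_, c', x :: t, rfl, h⟩
      simp [bpass, show ¬ x < c' by omega, hb]

theorem ncard_preS (l : List ℕ) (M c : ℕ) (hM : ∀ x ∈ l, x < M) (hn : l.Nodup) (hc : c < M)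
    (hcl : c ∉ l) : (preS c (l ++ [M])).ncard = 2 ^ (cnt c (l ++ [M]) - 1) := by
  induction l generalizing c with
  | nil =>
    have : preS c ([] ++ [M]) = {[M]} := by
      ext r
      simp only [preS, Set.mem_ofPred_eq, List.nil_append, Set.mem_singleton_iff]
      constructor
      · rintro ⟨h, -⟩
        have := bpass_perm r
        rw [h] at this
        exact (List.singleton_perm.1 this).symm
      · rintro rfl
        exact ⟨by simp [bpass], M, [], rfl, hc⟩
    rw [this]; simp [cnt, hc]
  | cons b l ih =>
    have hbM : b < M := hM b (by simp)
    have hM' : ∀ x ∈ l, x < M := fun x hx => hM x (by simp [hx])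
    rw [List.nodup_cons] at hn
    simp only [List.mem_cons, not_or] at hcl
    rw [List.cons_append]
    rcases lt_or_gt_of_ne hcl.1 with h | h
    · have hbl : b ∉ l ++ [M] := by simp [hn.1]; omega
      rw [preS_gt c b _ (by simp) h hbl]
      have e := ih b hM' hn.2 hbM hn.1
      have hfin : (preS b (l ++ [M])).Finite := Set.finite_of_ncard_pos (by rw [e]; positivity)
      rw [Set.ncard_union_eq _ (hfin.image _) (hfin.image _),
        Set.ncard_image_of_injective _ (ins2_inj b),
        Set.ncard_image_of_injective _ List.cons_injective, e]
      · have := cnt_pos b (l ++ [M]) M (by simp) hbM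
        simp only [cnt, h, if_true]
        obtain ⟨q, hq⟩ : ∃ q, cnt b (l ++ [M]) = q + 1 := ⟨_, (Nat.sub_add_cancel this).symm⟩
        rw [hq, Nat.add_sub_cancel, show 1 + (q + 1) - 1 = q + 1 by omega, pow_succ]
        ring
      · rw [Set.disjoint_left]
        rintro _ ⟨_, ⟨_, x, t, rfl, hx⟩, rfl⟩ ⟨_, _, h2⟩
        simp only [ins2, List.cons.injEq] at h2
        omega
    · rw [preS_lt c b _ (by simp) h, Set.ncard_image_of_injective _ (ins2_inj b),
        ih c hM' hn.2 hc hcl.2]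
      simp [cnt, show ¬ c < b by omega]

/-- All preimages of a nodup list of positive naturals ending in its maximum. -/
theorem ncard_pre (l : List ℕ) (M : ℕ) (hM : ∀ x ∈ l, x < M) (hn : l.Nodup)
    (hpos : ∀ x ∈ l ++ [M], 0 < x) :
    {r | bpass r = l ++ [M]}.ncard = 2 ^ (ltrCount (l ++ [M]) - 1) := by
  rw [ltrCount_eq _ hpos, ← ncard_preS l M 0 hM hn (hpos M (by simp))
    (fun h => absurd (hpos 0 (by simp [h])) (by simp))]
  congr 1
  ext r
  simp only [preS, Set.mem_ofPred_eq]
  refine ⟨fun h => ⟨h, ?_⟩, fun h => h.1⟩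
  cases r with
  | nil => simp [bpass] at h
  | cons x t =>
    refine ⟨x, t, rfl, hpos x ?_⟩
    rw [← h, (bpass_perm _).mem_iff]; simp

theorem child_iff (n : ℕ) (π : List ℕ) (hπ : IsPermList n π) (hne : π ≠ idList n) :
    {τ : List ℕ | IsPermList n τ ∧ bpass τ = π ∧ τ ≠ π} = {r | bpass r = π} := by
  ext τ
  simp only [Set.mem_ofPred_eq]
  refine ⟨fun h => h.2.1, fun h => ⟨?_, h, ?_⟩⟩
  · have := bpass_perm τ
    rw [h] at this
    exact this.symm.trans hπ
  · rintro rfl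
    exact hne (hπ.eq_of_pairwise (fun a b _ _ h1 h2 => le_antisymm h1 h2) (bpass_fixed _ h) (idList_sorted n))

theorem split_last (n : ℕ) (l : List ℕ) (h : IsPermList n (l ++ [n])) :
    (∀ x ∈ l, x < n) ∧ l.Nodup ∧ (∀ x ∈ l ++ [n], 0 < x) := by
  have hnd : (l ++ [n]).Nodup := h.nodup_iff.2 (idList_nodup n)
  have hm : ∀ x ∈ l ++ [n], 1 ≤ x ∧ x ≤ n := fun x hx =>
    (mem_idList n x).1 (h.mem_iff.1 hx)
  refine ⟨fun x hx => ?_, (List.nodup_append.1 hnd).1, fun x hx => (hm x hx).1⟩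
  have h1 := (hm x (by simp [hx])).2
  have h2 : x ≠ n := (List.nodup_append.1 hnd).2.2 x hx n (by simp)
  omega

theorem ncard_child (n : ℕ) (l : List ℕ) (hπ : IsPermList n (l ++ [n]))
    (hne : l ++ [n] ≠ idList n) :
    Set.ncard {τ : List ℕ | IsPermList n τ ∧ bpass τ = l ++ [n] ∧ τ ≠ l ++ [n]}
      = 2 ^ (ltrCount (l ++ [n]) - 1) := by
  obtain ⟨h1, h2, h3⟩ := split_last n l hπ
  rw [child_iff n _ hπ hne, ncard_pre l n h1 h2 h3]

theorem nonleaf_iff (n : ℕ) (hn : 0 < n) (τ : List ℕ) (h : IsPermList n τ) (hne : τ ≠ idList n) :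
    ¬ IsLeafNode n τ ↔ ∃ l, τ = l ++ [n] := by
  unfold IsLeafNode
  rw [not_not]
  constructor
  · rintro ⟨ρ, hρ, -, hb⟩
    have hmem : n ∈ ρ := hρ.mem_iff.2 ((mem_idList n n).2 ⟨hn, le_rfl⟩)
    obtain ⟨l0, M, h1, h2⟩ := bpass_last ρ (List.ne_nil_of_mem hmem)
    have := h2 n hmem
    have hM : M ∈ ρ := by rw [← (bpass_perm ρ).mem_iff, h1]; simp
    have := ((mem_idList n M).1 (hρ.mem_iff.1 hM)).2
    have : M = n := by omega
    subst this
    exact ⟨l0, hb ▸ h1⟩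
  · rintro ⟨l, rfl⟩
    have := ncard_child n l h hne
    have hpos : 0 < Set.ncard {τ : List ℕ | IsPermList n τ ∧ bpass τ = l ++ [n] ∧ τ ≠ l ++ [n]} := by
      rw [this]; positivity
    obtain ⟨ρ, h1, h2, h3⟩ := Set.nonempty_of_ncard_ne_zero hpos.ne'
    exact ⟨ρ, h1, h3, h2⟩

theorem stmt_13 (n k m : ℕ) (π : List ℕ) (hπ : IsPermList n π) (hne : π ≠ idList n)
    (hlast : π.getLast? = some n) (hk : ltrCount π = k) (hm : suffLen π = m) :
    Set.ncard {τ : List ℕ | IsPermList n τ ∧ bpass τ = π ∧ τ ≠ π} = 2 ^ (k - 1) ∧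
    (2 ≤ m → Set.ncard {τ : List ℕ |
        (IsPermList n τ ∧ bpass τ = π ∧ τ ≠ π) ∧ IsLeafNode n τ} = 2 ^ (k - 2)) ∧
    (m = 1 → ∀ τ, IsPermList n τ → bpass τ = π → τ ≠ π → IsLeafNode n τ) := by
  obtain ⟨l, rfl⟩ : ∃ l, π = l ++ [n] := by
    rw [List.getLast?_eq_some_iff] at hlast
    exact hlast
  obtain ⟨h1, h2, h3⟩ := split_last n l hπ
  have hn : 0 < n := h3 n (by simp)
  have htot := ncard_child n l hπ hne
  rw [hk] at htot
  -- children are never the identity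
  have hnid : ∀ τ, bpass τ = l ++ [n] → τ ≠ idList n := by
    rintro τ h rfl
    rw [bpass_sorted _ (idList_sorted n)] at h
    exact hne h.symm
  -- `l` is nonempty
  rcases List.eq_nil_or_concat l with rfl | ⟨l0, b, rfl⟩
  · exfalso
    have hlen := hπ.length_eq
    simp [idList] at hlen
    subst hlen
    exact hne (by simp [idList])
  rw [List.concat_eq_append] at *
  have hbn : b < n := h1 b (by simp)
  obtain ⟨hs2, hs1⟩ := suffLen_append l0 b n (fun x hx => h1 x (by simp [hx])) hbn
  rw [hm] at hs2 hs1
  -- nonleaf children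
  have hnl : ∀ τ, IsPermList n τ → bpass τ = l0 ++ [b] ++ [n] → ¬ IsLeafNode n τ →
      ∃ r, τ = r ++ [n] ∧ bpass r = l0 ++ [b] := by
    intro τ hp hb hl
    obtain ⟨r, rfl⟩ := (nonleaf_iff n hn τ hp (hnid τ hb)).1 hl
    refine ⟨r, rfl, ?_⟩
    rw [bpass_append r n (fun x hx => ((split_last n r hp).1 x hx).le)] at hb
    exact List.append_cancel_right hb
  have hnd0 : l0.Nodup ∧ ∀ x ∈ l0, x ≠ b := by
    rw [List.nodup_append] at h2
    exact ⟨h2.1, fun x hx => h2.2.2 x hx b (by simp)⟩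
  refine ⟨htot, fun hm2 => ?_, fun hm1 τ hp hb hτ => ?_⟩
  · have hlt := hs2.1 hm2
    have hc := ncard_pre l0 b hlt hnd0.1 (fun x hx => h3 x (by simp at hx ⊢; tauto))
    have hpos : 0 < ltrCount (l0 ++ [b]) := by
      rw [ltrCount_append, if_pos hlt]; omega
    have hk' : k = ltrCount (l0 ++ [b]) + 1 := by
      rw [← hk, ltrCount_append, if_pos h1]
    set S := {τ : List ℕ | IsPermList n τ ∧ bpass τ = l0 ++ [b] ++ [n] ∧ τ ≠ l0 ++ [b] ++ [n]}
      with hS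
    have hSfin : S.Finite := Set.finite_of_ncard_pos (by rw [htot]; positivity)
    have hT : {τ | τ ∈ S ∧ ¬ IsLeafNode n τ} = (fun r => r ++ [n]) '' {r | bpass r = l0 ++ [b]} := by
      ext τ
      simp only [Set.mem_ofPred_eq, Set.mem_image]
      constructor
      · rintro ⟨h, hl⟩
        obtain ⟨r, hr, hb⟩ := hnl τ h.1 h.2.1 hl
        exact ⟨r, hb, hr.symm⟩
      · rintro ⟨r, hr, rfl⟩
        have hb : bpass (r ++ [n]) = l0 ++ [b] ++ [n] := by
          rw [bpass_append, hr]
          intro x hx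
          refine (h1 x ?_).le
          rw [← hr, (bpass_perm r).mem_iff]; exact hx
        have hS' : r ++ [n] ∈ S := by
          rw [hS, child_iff n _ hπ hne]; exact hb
        exact ⟨hS', (nonleaf_iff n hn _ hS'.1 (hnid _ hb)).2 ⟨r, rfl⟩⟩
    have hTc : {τ | τ ∈ S ∧ ¬ IsLeafNode n τ}.ncard = 2 ^ (k - 2) := by
      rw [hT, Set.ncard_image_of_injective _ (fun a b h => List.append_cancel_right h), hc, hk']
      rfl
    have hsum : {τ | τ ∈ S ∧ IsLeafNode n τ}.ncard + {τ | τ ∈ S ∧ ¬ IsLeafNode n τ}.ncard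
        = S.ncard := by
      rw [← Set.ncard_union_eq _ (hSfin.subset fun _ h => h.1) (hSfin.subset fun _ h => h.1)]
      · congr 1
        ext τ
        simp only [Set.mem_union, Set.mem_ofPred_eq]
        tauto
      · rw [Set.disjoint_left]
        exact fun _ h h' => h'.2 h.2
    rw [hTc, htot] at hsum
    have h2k : 2 ^ (k - 1) = 2 ^ (k - 2) + 2 ^ (k - 2) := by
      rw [show k - 1 = (k - 2) + 1 by omega, pow_succ]; ring
    have : {τ | τ ∈ S ∧ IsLeafNode n τ}.ncard = 2 ^ (k - 2) := by omega
    exact this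
  · by_contra hl
    obtain ⟨r, -, hr⟩ := hnl τ hp hb hl
    have hrne : r ≠ [] := by rintro rfl; simp [bpass] at hr
    obtain ⟨l1, M, e1, e2⟩ := bpass_last r hrne
    rw [hr] at e1
    obtain ⟨-, e3⟩ := List.append_inj' e1 rfl
    simp only [List.cons.injEq, and_true] at e3
    have : 2 ≤ m := hs2.2 (by
      intro x hx
      have h4 := e2 x (by rw [← (bpass_perm r).mem_iff, hr]; simp [hx])
      have h5 := hnd0.2 x hx
      omega)
    omega
end

section
/- Let π be a permutation with k left-to-right maxima whose longest suffix of left-to-right maxima has length m ≥ 1, and π not an identity permutation. Then for every 1 ≤ j < m, among the nodes at height j in the tree T(π) of iterated bubblesort preimages, the proportion of leaves is exactly j/(j+1): the number of leaves at height j is j!·j·(j+1)^(k−j−1) while the total number of nodes at height j is j!·(j+1)^(k−j). -/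
/-- Decode an inversion code into a word on `s, s+1, ...`. -/
def bsDec : ℕ → List ℕ → List ℕ
  | _, [] => []
  | s, c :: cs => (bsDec (s + 1) cs).insertIdx c s

/-- Valid codes. -/
def bsV : List ℕ → Prop
  | [] => True
  | c :: cs => c ≤ cs.length ∧ bsV cs

/-- Codes that have a preimage. -/
def bsP : List ℕ → Prop
  | [] => True
  | c :: cs => (c = 0 ∨ c + 1 ≤ cs.length) ∧ bsP cs

/-- Codes whose last `j+1` positions are left-to-right maxima. -/
def bsG (j : ℕ) : List ℕ → Prop
  | [] => True
  | c :: cs => (c = 0 ∨ c + (j + 1) ≤ cs.length) ∧ bsG j cs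

/-- Products of sets of options. -/
def bsF (o : ℕ → ℕ → Finset ℕ) : List ℕ → Finset (List ℕ)
  | [] => {[]}
  | c :: cs => (o c cs.length ×ˢ bsF o cs).image fun p => p.1 :: p.2

theorem bsF_card_cons (o : ℕ → ℕ → Finset ℕ) (c : ℕ) (cs : List ℕ) :
    (bsF o (c :: cs)).card = (o c cs.length).card * (bsF o cs).card := by
  rw [bsF, Finset.card_image_of_injective, Finset.card_product]
  rintro ⟨a, b⟩ ⟨a', b'⟩ h
  simpa using h

theorem bsV_map (j : ℕ) : ∀ cs, bsV cs → bsV (cs.map (· - j))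
  | [], _ => trivial
  | c :: cs, h => by
    refine ⟨?_, bsV_map j cs h.2⟩
    have := h.1
    simp only [List.length_map]
    omega

theorem bsDec_perm : ∀ (cs : List ℕ) (s : ℕ), bsV cs → (bsDec s cs).Perm (List.range' s cs.length)
  | [], _, _ => by simp [bsDec]
  | c :: cs, s, h => by
    have ih := bsDec_perm cs (s + 1) h.2
    have hl := ih.length_eq
    simp only [List.length_range'] at hl
    rw [bsDec, List.length_cons, List.range'_succ]
    exact (List.perm_insertIdx s _ (by rw [hl]; exact h.1)).trans (ih.cons s)

theorem bsDec_length (cs : List ℕ) (s : ℕ) (h : bsV cs) : (bsDec s cs).length = cs.length := by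
  simpa using (bsDec_perm cs s h).length_eq

theorem bsDec_gt (cs : List ℕ) (s : ℕ) (h : bsV cs) : ∀ x ∈ bsDec (s + 1) cs, s < x := by
  intro x hx
  have := (bsDec_perm cs (s + 1) h).subset hx
  rw [List.mem_range'_1] at this
  omega

theorem bpass_insertIdx (i : ℕ) : ∀ (N : ℕ) (l : List ℕ) (c : ℕ), l.length ≤ N → c ≤ l.length →
    (∀ x ∈ l, i < x) → bpass (l.insertIdx c i) = (bpass l).insertIdx (c - 1) i := by
  intro N
  induction N with
  | zero =>
    intro l c hl hc _
    have : l = [] := by simpa using hl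
    subst this
    have : c = 0 := by simpa using hc
    subst this
    simp [bpass]
  | succ N ih =>
    intro l c hl hc hx
    match l, c with
    | [], c =>
      have : c = 0 := by simpa using hc
      subst this
      simp [bpass]
    | a :: l, 0 =>
      have : i < a := hx a (by simp)
      simp [bpass, this.not_gt]
    | a :: l, 1 =>
      have : i < a := hx a (by simp)
      simp [bpass, this]
    | [a], c + 2 => simp at hc
    | a :: b :: l, c + 2 =>
      have h1 := ih (a :: l) (c + 1) (by simpa using hl) (by simpa using hc)
        (fun x h => hx x (by simp at h ⊢; tauto))
      have h2 := ih (b :: l) (c + 1) (by simpa using hl) (by simpa using hc)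
        (fun x h => hx x (by simp at h ⊢; tauto))
      simp only [List.insertIdx_succ_cons] at h1 h2 ⊢
      simp only [bpass]
      split_ifs
      · rw [h1]; simp
      · rw [h2]; simp

theorem bpass_bsDec : ∀ (cs : List ℕ) (s : ℕ), bsV cs →
    bpass (bsDec s cs) = bsDec s (cs.map (· - 1))
  | [], _, _ => by simp [bsDec, bpass]
  | c :: cs, s, h => by
    rw [bsDec, bpass_insertIdx s _ _ c le_rfl (by rw [bsDec_length _ _ h.2]; exact h.1)
      (bsDec_gt cs s h.2), bpass_bsDec cs (s + 1) h.2]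
    simp [bsDec]

theorem bpass_iter_bsDec (s : ℕ) (cs : List ℕ) (h : bsV cs) : ∀ (j : ℕ),
    bpass^[j] (bsDec s cs) = bsDec s (cs.map (· - j))
  | 0 => by simp
  | j + 1 => by
    rw [Function.iterate_succ_apply', bpass_iter_bsDec s cs h j, bpass_bsDec _ _ (bsV_map j cs h)]
    simp [Function.comp_def, Nat.sub_sub]

theorem bsDec_surj : ∀ (d s : ℕ) (σ : List ℕ), σ.Perm (List.range' s d) →
    ∃ cs, bsV cs ∧ cs.length = d ∧ bsDec s cs = σ
  | 0, s, σ, h => ⟨[], trivial, rfl, by simpa [bsDec, eq_comm] using h⟩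
  | d + 1, s, σ, h => by
    have hm : s ∈ σ := h.symm.subset (by simp [List.mem_range'_1])
    have h2 : (σ.erase s).Perm (List.range' (s + 1) d) := by
      have := h.erase s
      rwa [List.range'_succ, List.erase_cons_head] at this
    obtain ⟨cs, hv, hl, hd⟩ := bsDec_surj d (s + 1) _ h2
    have hlt : σ.idxOf s < σ.length := List.idxOf_lt_length_iff.2 hm
    have hσ : σ.length = d + 1 := by simpa using h.length_eq
    refine ⟨σ.idxOf s :: cs, ⟨by omega, hv⟩, by simp [hl], ?_⟩
    rw [bsDec, hd, List.erase_eq_eraseIdx_of_idxOf rfl]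
    have := List.insertIdx_eraseIdx_getElem hlt
    simpa using this

theorem bs_idxOf_insertIdx (s : ℕ) : ∀ (l : List ℕ) (c : ℕ), c ≤ l.length → s ∉ l →
    (l.insertIdx c s).idxOf s = c
  | l, 0, _, _ => by simp
  | [], c + 1, h, _ => by simp at h
  | a :: l, c + 1, h, hs => by
    simp only [List.mem_cons, not_or] at hs
    rw [List.insertIdx_succ_cons, List.idxOf_cons_ne _ (fun h => hs.1 h.symm),
      bs_idxOf_insertIdx s l c (by simpa using h) hs.2]

theorem bsDec_inj : ∀ (cs ds : List ℕ) (s : ℕ), bsV cs → bsV ds → bsDec s cs = bsDec s ds → cs = ds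
  | [], [], _, _, _, _ => rfl
  | [], d :: ds, s, hc, hd, h => by
    have := congrArg List.length h
    rw [bsDec_length _ _ hc, bsDec_length _ _ hd] at this
    simp at this
  | c :: cs, [], s, hc, hd, h => by
    have := congrArg List.length h
    rw [bsDec_length _ _ hc, bsDec_length _ _ hd] at this
    simp at this
  | c :: cs, d :: ds, s, hc, hd, h => by
    simp only [bsDec] at h
    have e1 := bs_idxOf_insertIdx s (bsDec (s + 1) cs) c
      (by rw [bsDec_length _ _ hc.2]; exact hc.1) (fun h => (bsDec_gt cs s hc.2 s h).false)
    have e2 := bs_idxOf_insertIdx s (bsDec (s + 1) ds) d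
      (by rw [bsDec_length _ _ hd.2]; exact hd.1) (fun h => (bsDec_gt ds s hd.2 s h).false)
    rw [h, e2] at e1
    subst e1
    have h3 := congrArg (fun l => l.eraseIdx d) h
    simp only [List.eraseIdx_insertIdx_self] at h3
    rw [bsDec_inj cs ds (s + 1) hc.2 hd.2 h3]

theorem bsDec_zero : ∀ (cs : List ℕ) (s : ℕ), (∀ c ∈ cs, c = 0) →
    bsDec s cs = List.range' s cs.length
  | [], s, _ => by simp [bsDec]
  | c :: cs, s, h => by
    have h0 : c = 0 := h c (by simp)
    subst h0
    rw [bsDec, bsDec_zero cs (s + 1) (fun c hc => h c (by simp [hc]))]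
    simp [List.range'_succ]

theorem idList_eq (n : ℕ) : idList n = List.range' 1 n := by
  simp [idList, List.range'_eq_map_range, add_comm]

theorem bs_getD_insertIdx (l : List ℕ) (c s p : ℕ) (hc : c ≤ l.length) :
    (l.insertIdx c s).getD p 0 =
      if p < c then l.getD p 0 else if p = c then s else l.getD (p - 1) 0 := by
  simp only [List.getD_eq_getElem?_getD, List.getElem?_insertIdx]
  split_ifs <;> simp_all

theorem isLTRMax_insertIdx (l : List ℕ) (c s p : ℕ) (hc : c ≤ l.length) (hs : ∀ x ∈ l, s < x) :
    IsLTRMax (l.insertIdx c s) p ↔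
      if p < c then IsLTRMax l p else if p = c then c = 0 else IsLTRMax l (p - 1) := by
  have hg : ∀ q, q < l.length → s < l.getD q 0 := by
    intro q hq
    rw [List.getD_eq_getElem _ _ hq]
    exact hs _ (List.getElem_mem hq)
  simp only [IsLTRMax, List.length_insertIdx_of_le_length hc, bs_getD_insertIdx l c s _ hc]
  split_ifs with h1 h2
  · constructor
    · rintro ⟨_, h⟩
      refine ⟨by omega, fun i hi => ?_⟩
      have := h i hi
      rwa [if_pos (by omega)] at this
    · rintro ⟨_, h⟩
      refine ⟨by omega, fun i hi => ?_⟩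
      rw [if_pos (by omega)]
      exact h i hi
  · subst h2
    constructor
    · rintro ⟨_, h⟩
      by_contra h0
      have := h 0 (by omega)
      rw [if_pos (by omega)] at this
      have := hg 0 (by omega)
      omega
    · rintro rfl
      exact ⟨by omega, by simp⟩
  · constructor
    · rintro ⟨_, h⟩
      refine ⟨by omega, fun i hi => ?_⟩
      by_cases hic : i < c
      · have := h i (by omega)
        rwa [if_pos hic] at this
      · have := h (i + 1) (by omega)
        rwa [if_neg (by omega), if_neg (by omega), Nat.add_sub_cancel] at this
    · rintro ⟨h3, h⟩
      refine ⟨by omega, fun i hi => ?_⟩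
      split_ifs with h4 h5
      · exact h i (by omega)
      · exact hg _ h3
      · exact h (i - 1) (by omega)

theorem ltrCount_insertIdx (l : List ℕ) (c s : ℕ) (hc : c ≤ l.length) (hs : ∀ x ∈ l, s < x) :
    ltrCount (l.insertIdx c s) = ltrCount l + if c = 0 then 1 else 0 := by
  obtain ⟨r, hr⟩ := Nat.exists_eq_add_of_le hc
  simp only [ltrCount, ← List.countP_eq_length_filter, List.length_insertIdx_of_le_length hc,
    isLTRMax_insertIdx l c s _ hc hs, hr]
  rw [show c + r + 1 = c + (1 + r) by ring]
  simp only [List.range_add, List.countP_append, List.countP_map]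
  have e1 : List.countP (fun x => decide (if x < c then IsLTRMax l x else
      if x = c then c = 0 else IsLTRMax l (x - 1))) (List.range c) =
      List.countP (fun x => decide (IsLTRMax l x)) (List.range c) := by
    apply List.countP_congr
    intro x hx
    simp [List.mem_range.1 hx]
  rw [e1]
  have e2 : ∀ x, c + (1 + x) - 1 = c + x := by intro x; omega
  simp [Function.comp_def, e2]
  split_ifs <;> omega

theorem ltrCount_bsDec : ∀ (cs : List ℕ) (s : ℕ), bsV cs → ltrCount (bsDec s cs) = cs.count 0
  | [], _, _ => by simp [bsDec, ltrCount]
  | c :: cs, s, h => by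
    rw [bsDec, ltrCount_insertIdx _ c s (by rw [bsDec_length _ _ h.2]; exact h.1)
      (bsDec_gt cs s h.2), ltrCount_bsDec cs (s + 1) h.2, List.count_cons]
    simp

theorem bsG_of_ltr (j : ℕ) : ∀ (cs : List ℕ) (s : ℕ), bsV cs →
    (∀ p < cs.length, cs.length ≤ p + j + 1 → IsLTRMax (bsDec s cs) p) → bsG j cs
  | [], _, _, _ => trivial
  | c :: cs, s, h, hp => by
    have hc := h.1
    have key : ∀ p, IsLTRMax (bsDec s (c :: cs)) p ↔ _ := fun p =>
      isLTRMax_insertIdx (bsDec (s + 1) cs) c s p (by rw [bsDec_length _ _ h.2]; exact h.1)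
        (bsDec_gt cs s h.2)
    have h1 : c = 0 ∨ c + (j + 1) ≤ cs.length := by
      by_contra hcon
      push Not at hcon
      have := hp c (by simp; omega) (by simp; omega)
      rw [key] at this
      simp at this
      exact hcon.1 this
    refine ⟨h1, bsG_of_ltr j cs (s + 1) h.2 ?_⟩
    intro p hpl hpj
    have := hp (p + 1) (by simp; omega) (by simp; omega)
    rw [key, if_neg (by omega), if_neg (by omega), Nat.add_sub_cancel] at this
    exact this

theorem suffLen_spec (l : List ℕ) (j : ℕ) (h : j < suffLen l) :
    j < l.length ∧ ∀ p < l.length, l.length ≤ p + j + 1 → IsLTRMax l p := by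
  unfold suffLen at h
  have hpre := List.takeWhile_prefix (l := List.range l.length)
    (fun j => decide (IsLTRMax l (l.length - 1 - j)))
  have hle := hpre.length_le
  simp only [List.length_range] at hle
  refine ⟨by omega, fun p hp hpj => ?_⟩
  set t := l.length - 1 - p with ht
  have htl : t < ((List.range l.length).takeWhile
    fun j => decide (IsLTRMax l (l.length - 1 - j))).length := by omega
  have hmem := List.getElem_mem htl
  have hval := hpre.getElem htl
  rw [hval] at hmem
  have := List.mem_takeWhile_imp hmem
  simp only [List.getElem_range, decide_eq_true_eq] at this
  rwa [show l.length - 1 - t = p by omega] at this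

/-- options for nodes -/
def bsO (j c L : ℕ) : Finset ℕ := (Finset.range (L + 1)).filter fun d => d - j = c

/-- options for non-leaves -/
def bsO' (j c L : ℕ) : Finset ℕ :=
  (Finset.range (L + 1)).filter fun d => d - j = c ∧ (d = 0 ∨ d + 1 ≤ L)

theorem mem_bsF_bsO (j : ℕ) : ∀ cs ds : List ℕ,
    ds ∈ bsF (bsO j) cs ↔ bsV ds ∧ ds.map (· - j) = cs
  | [], ds => by
    simp only [bsF, Finset.mem_singleton, List.map_eq_nil_iff]
    constructor
    · rintro rfl; exact ⟨trivial, rfl⟩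
    · exact fun h => h.2
  | c :: cs, [] => by simp [bsF]
  | c :: cs, d :: ds => by
    simp only [bsF, Finset.mem_image, Finset.mem_product, mem_bsF_bsO j cs, Prod.exists,
      List.cons.injEq, bsO, Finset.mem_filter, Finset.mem_range, bsV, List.map_cons]
    constructor
    · rintro ⟨a, b, ⟨⟨h1, h2⟩, h3, h4⟩, rfl, rfl⟩
      have := congrArg List.length h4
      simp only [List.length_map] at this
      exact ⟨⟨by omega, h3⟩, h2, h4⟩
    · rintro ⟨⟨h1, h2⟩, h3, h4⟩
      have := congrArg List.length h4
      simp only [List.length_map] at this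
      exact ⟨d, ds, ⟨⟨by omega, h3⟩, h2, h4⟩, rfl, rfl⟩

theorem mem_bsF_bsO' (j : ℕ) : ∀ cs ds : List ℕ,
    ds ∈ bsF (bsO' j) cs ↔ (bsV ds ∧ ds.map (· - j) = cs) ∧ bsP ds
  | [], ds => by
    simp only [bsF, Finset.mem_singleton, List.map_eq_nil_iff]
    constructor
    · rintro rfl; exact ⟨⟨trivial, rfl⟩, trivial⟩
    · exact fun h => h.1.2
  | c :: cs, [] => by simp [bsF]
  | c :: cs, d :: ds => by
    simp only [bsF, Finset.mem_image, Finset.mem_product, mem_bsF_bsO' j cs, Prod.exists,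
      List.cons.injEq, bsO', Finset.mem_filter, Finset.mem_range, bsV, bsP, List.map_cons]
    constructor
    · rintro ⟨a, b, ⟨⟨h1, h2, h5⟩, ⟨h3, h4⟩, h6⟩, rfl, rfl⟩
      have := congrArg List.length h4
      simp only [List.length_map] at this
      exact ⟨⟨⟨by omega, h3⟩, h2, h4⟩, by omega, h6⟩
    · rintro ⟨⟨⟨h1, h2⟩, h3, h4⟩, h5, h6⟩
      have := congrArg List.length h4
      simp only [List.length_map] at this
      exact ⟨d, ds, ⟨⟨by omega, h3, by omega⟩, ⟨h2, h4⟩, h6⟩, rfl, rfl⟩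

theorem bsO_card_zero (j L : ℕ) : (bsO j 0 L).card = min j L + 1 := by
  have : bsO j 0 L = Finset.range (min j L + 1) := by
    ext d; simp only [bsO, Finset.mem_filter, Finset.mem_range]; omega
  rw [this, Finset.card_range]

theorem bsO_card_pos (j c L : ℕ) (hc : c ≠ 0) (h : c + (j + 1) ≤ L) : (bsO j c L).card = 1 := by
  have : bsO j c L = {c + j} := by
    ext d; simp only [bsO, Finset.mem_filter, Finset.mem_range, Finset.mem_singleton]; omega
  rw [this, Finset.card_singleton]

theorem bsO'_card_zero (j L : ℕ) : (bsO' j 0 L).card = min j (L - 1) + 1 := by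
  have : bsO' j 0 L = Finset.range (min j (L - 1) + 1) := by
    ext d; simp only [bsO', Finset.mem_filter, Finset.mem_range]; omega
  rw [this, Finset.card_range]

theorem bsO'_card_pos (j c L : ℕ) (hc : c ≠ 0) (h : c + (j + 1) ≤ L) : (bsO' j c L).card = 1 := by
  have : bsO' j c L = {c + j} := by
    ext d; simp only [bsO', Finset.mem_filter, Finset.mem_range, Finset.mem_singleton]; omega
  rw [this, Finset.card_singleton]

theorem bsG_count (j : ℕ) : ∀ cs, bsG j cs → min cs.length (j + 1) ≤ cs.count 0
  | [], _ => by simp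
  | c :: cs, h => by
    have ih := bsG_count j cs h.2
    rw [List.count_cons]
    rcases h.1 with h0 | h0
    · simp [h0]; omega
    · simp; omega

theorem bs_total (j : ℕ) : ∀ cs, bsG j cs →
    (cs.length ≤ j → (bsF (bsO j) cs).card = cs.length.factorial) ∧
    (j ≤ cs.length → (bsF (bsO j) cs).card = j.factorial * (j + 1) ^ (cs.count 0 - j))
  | [], _ => by
    refine ⟨fun _ => by simp [bsF], fun h => ?_⟩
    have : j = 0 := by simpa using h
    subst this
    simp [bsF]
  | c :: cs, h => by
    obtain ⟨i1, i2⟩ := bs_total j cs h.2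
    have hc := bsG_count j cs h.2
    have A : (c :: cs).length ≤ j →
        (bsF (bsO j) (c :: cs)).card = (c :: cs).length.factorial := by
      intro hl
      rw [List.length_cons] at hl
      have h0 : c = 0 := by have := h.1; omega
      subst h0
      rw [bsF_card_cons, bsO_card_zero, i1 (by omega), min_eq_right (by omega), List.length_cons,
        Nat.factorial_succ]
    refine ⟨A, fun hl => ?_⟩
    rcases hl.eq_or_lt with he | hlt
    · rw [A he.symm.le, ← he]
      have h1 := List.count_le_length (a := 0) (l := c :: cs)
      rw [← he] at h1
      rw [Nat.sub_eq_zero_of_le h1]; simp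
    · rw [List.length_cons] at hlt
      rw [bsF_card_cons, i2 (by omega)]
      by_cases h0 : c = 0
      · subst h0
        rw [bsO_card_zero, min_eq_left (by omega), List.count_cons_self,
          Nat.succ_sub (by omega), pow_succ]
        ring
      · rw [bsO_card_pos j c _ h0 (by have := h.1; omega), List.count_cons_of_ne h0, one_mul]

theorem bs_nonleaf (j : ℕ) : ∀ cs, bsG j cs →
    (cs.length ≤ j + 1 → (bsF (bsO' j) cs).card = (cs.length - 1).factorial) ∧
    (j + 1 ≤ cs.length →
      (bsF (bsO' j) cs).card = j.factorial * (j + 1) ^ (cs.count 0 - (j + 1)))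
  | [], _ => by
    refine ⟨fun _ => by simp [bsF], fun h => ?_⟩
    simp at h
  | c :: cs, h => by
    obtain ⟨i1, i2⟩ := bs_nonleaf j cs h.2
    have hc := bsG_count j cs h.2
    have A : (c :: cs).length ≤ j + 1 →
        (bsF (bsO' j) (c :: cs)).card = ((c :: cs).length - 1).factorial := by
      intro hl
      rw [List.length_cons] at hl
      have h0 : c = 0 := by have := h.1; omega
      subst h0
      rw [bsF_card_cons, bsO'_card_zero, i1 (by omega), min_eq_right (by omega), List.length_cons]
      rcases Nat.eq_zero_or_pos cs.length with hz | hz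
      · simp [hz]
      · rw [Nat.add_sub_cancel, Nat.sub_add_cancel hz, Nat.mul_factorial_pred (by omega)]
    refine ⟨A, fun hl => ?_⟩
    rcases hl.eq_or_lt with he | hlt
    · rw [A he.symm.le, ← he]
      have h1 := List.count_le_length (a := 0) (l := c :: cs)
      rw [← he] at h1
      rw [Nat.sub_eq_zero_of_le h1]; simp
    · rw [List.length_cons] at hlt
      rw [bsF_card_cons, i2 (by omega)]
      by_cases h0 : c = 0
      · subst h0
        rw [bsO'_card_zero, min_eq_left (by omega), List.count_cons_self,
          Nat.succ_sub (by omega), pow_succ]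
        ring
      · rw [bsO'_card_pos j c _ h0 (by have := h.1; omega), List.count_cons_of_ne h0, one_mul]

theorem bsP_iff : ∀ ds, bsP ds ↔ ∃ es, bsV es ∧ es.map (· - 1) = ds
  | [] => by
    refine ⟨fun _ => ⟨[], trivial, rfl⟩, fun _ => trivial⟩
  | d :: ds => by
    have ih := bsP_iff ds
    constructor
    · rintro ⟨h1, h2⟩
      obtain ⟨es, h3, h4⟩ := ih.1 h2
      have := congrArg List.length h4
      simp only [List.length_map] at this
      refine ⟨(if d = 0 then 0 else d + 1) :: es, ⟨?_, h3⟩, ?_⟩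
      · split_ifs <;> omega
      · rw [List.map_cons, h4]; split_ifs <;> simp_all
    · rintro ⟨es, h3, h4⟩
      match es, h3, h4 with
      | e :: es, h3, h4 =>
        simp only [List.map_cons, List.cons.injEq] at h4
        have := congrArg List.length h4.2
        simp only [List.length_map] at this
        have h5 := h3.1
        exact ⟨by omega, ih.2 ⟨es, h3.2, h4.2⟩⟩

theorem bs_map_ne (cs ds : List ℕ) (i j : ℕ) (hij : i < j) (hi : ds.map (· - i) = cs)
    (hj : ds.map (· - j) = cs) : ∀ c ∈ cs, c = 0 := by
  intro c hc
  rw [List.mem_iff_getElem] at hc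
  obtain ⟨p, hp, rfl⟩ := hc
  have hl : ds.length = cs.length := by simpa using congrArg List.length hi
  have h1 : ds[p] - i = cs[p] := by simp [← hi]
  have h2 : ds[p] - j = cs[p] := by simp [← hj]
  omega

theorem stmt_19 (n k m : ℕ) (π : List ℕ) (hπ : IsPermList n π) (hne : π ≠ idList n)
    (hk : ltrCount π = k) (hm : suffLen π = m) (hm1 : 1 ≤ m)
    (j : ℕ) (hj1 : 1 ≤ j) (hjm : j < m) :
    Set.ncard {σ : List ℕ | IsNodeAt n π σ j ∧ IsLeafNode n σ} =
      Nat.factorial j * j * (j + 1) ^ (k - j - 1) ∧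
    Set.ncard {σ : List ℕ | IsNodeAt n π σ j} = Nat.factorial j * (j + 1) ^ (k - j) ∧
    (j + 1) * Set.ncard {σ : List ℕ | IsNodeAt n π σ j ∧ IsLeafNode n σ} =
      j * Set.ncard {σ : List ℕ | IsNodeAt n π σ j} := by
  have hπ' := hπ
  rw [IsPermList, idList_eq] at hπ'
  obtain ⟨cs, hv, hl, rfl⟩ := bsDec_surj n 1 π hπ'
  subst hm
  obtain ⟨s1, s2⟩ := suffLen_spec _ _ hjm
  rw [bsDec_length _ _ hv] at s1 s2
  have hG : bsG j cs := bsG_of_ltr j cs 1 hv s2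
  rw [ltrCount_bsDec _ _ hv] at hk
  have hcnt := bsG_count j cs hG
  have hnz : ¬ ∀ c ∈ cs, c = 0 := by
    intro h
    apply hne
    rw [bsDec_zero cs 1 h, idList_eq, hl]
  have hperm : ∀ σ, IsPermList n σ ↔ ∃ ds, bsV ds ∧ ds.length = n ∧ bsDec 1 ds = σ := by
    intro σ
    rw [IsPermList, idList_eq]
    constructor
    · exact bsDec_surj n 1 σ
    · rintro ⟨ds, h1, h2, rfl⟩
      rw [← h2]
      exact bsDec_perm ds 1 h1
  have hnode : ∀ ds, bsV ds →
      (IsNodeAt n (bsDec 1 cs) (bsDec 1 ds) j ↔ ds.map (· - j) = cs) := by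
    intro ds hd
    constructor
    · rintro ⟨_, h, _⟩
      rw [bpass_iter_bsDec _ _ hd] at h
      exact bsDec_inj _ _ _ (bsV_map j ds hd) hv h
    · intro h
      refine ⟨(hperm _).2 ⟨ds, hd, ?_, rfl⟩, ?_, ?_⟩
      · rw [← hl, ← h, List.length_map]
      · rw [bpass_iter_bsDec _ _ hd, h]
      · intro i hi hcon
        rw [bpass_iter_bsDec _ _ hd] at hcon
        exact hnz (bs_map_ne cs ds i j hi (bsDec_inj _ _ _ (bsV_map i ds hd) hv hcon) h)
  have hleaf : ∀ ds, bsV ds → ds.map (· - j) = cs → (IsLeafNode n (bsDec 1 ds) ↔ ¬ bsP ds) := by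
    intro ds hd h
    rw [IsLeafNode, bsP_iff, not_iff_not]
    constructor
    · rintro ⟨ρ, h1, h2, h3⟩
      obtain ⟨es, he, _, rfl⟩ := (hperm _).1 h1
      rw [bpass_bsDec _ _ he] at h3
      exact ⟨es, he, bsDec_inj _ _ _ (bsV_map 1 es he) hd h3⟩
    · rintro ⟨es, he, h3⟩
      refine ⟨bsDec 1 es, (hperm _).2 ⟨es, he, ?_, rfl⟩, ?_, ?_⟩
      · rw [← hl, ← h, ← h3]; simp
      · intro hcon
        have := bsDec_inj _ _ _ he hd hcon
        subst this
        apply hnz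
        intro c hc
        rw [← h] at hc
        obtain ⟨e, he', rfl⟩ := List.mem_map.1 hc
        have := bs_map_ne es es 0 1 (by omega) (by simp) h3 e he'
        omega
      · rw [bpass_bsDec _ _ he, h3]
  have hinj : ∀ S : Finset (List ℕ), (∀ ds ∈ S, bsV ds) →
      (bsDec 1 '' (S : Set (List ℕ))).ncard = S.card := by
    intro S hS
    rw [Set.ncard_image_of_injOn, Set.ncard_coe_finset]
    intro a ha b hb hab
    exact bsDec_inj a b 1 (hS a ha) (hS b hb) hab
  have hT : {σ : List ℕ | IsNodeAt n (bsDec 1 cs) σ j} = bsDec 1 '' (bsF (bsO j) cs : Set _) := by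
    ext σ
    simp only [Set.mem_setOf_eq, Set.mem_image, Finset.mem_coe, mem_bsF_bsO]
    constructor
    · intro h
      obtain ⟨ds, hd, _, rfl⟩ := (hperm _).1 h.1
      exact ⟨ds, ⟨hd, (hnode ds hd).1 h⟩, rfl⟩
    · rintro ⟨ds, ⟨hd, h⟩, rfl⟩
      exact (hnode ds hd).2 h
  have hL : {σ : List ℕ | IsNodeAt n (bsDec 1 cs) σ j ∧ IsLeafNode n σ} =
      bsDec 1 '' ((bsF (bsO j) cs \ bsF (bsO' j) cs : Finset _) : Set _) := by
    ext σ
    simp only [Set.mem_setOf_eq, Set.mem_image, Finset.mem_coe, Finset.mem_sdiff, mem_bsF_bsO,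
      mem_bsF_bsO']
    constructor
    · rintro ⟨h, h'⟩
      obtain ⟨ds, hd, _, rfl⟩ := (hperm _).1 h.1
      have e := (hnode ds hd).1 h
      exact ⟨ds, ⟨⟨hd, e⟩, fun hh => (hleaf ds hd e).1 h' hh.2⟩, rfl⟩
    · rintro ⟨ds, ⟨⟨hd, h⟩, h'⟩, rfl⟩
      exact ⟨(hnode ds hd).2 h, (hleaf ds hd h).2 fun hh => h' ⟨⟨hd, h⟩, hh⟩⟩
  have hsub : bsF (bsO' j) cs ⊆ bsF (bsO j) cs := by
    intro ds h
    exact (mem_bsF_bsO j cs ds).2 ((mem_bsF_bsO' j cs ds).1 h).1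
  have cT : Set.ncard {σ : List ℕ | IsNodeAt n (bsDec 1 cs) σ j} =
      Nat.factorial j * (j + 1) ^ (k - j) := by
    rw [hT, hinj _ (fun ds h => ((mem_bsF_bsO j cs ds).1 h).1), (bs_total j cs hG).2 (by omega), hk]
  have hpow : (j + 1) ^ (k - j) = (j + 1) ^ (k - j - 1) * (j + 1) := by
    rw [← pow_succ]
    congr 1
    omega
  have cL : Set.ncard {σ : List ℕ | IsNodeAt n (bsDec 1 cs) σ j ∧ IsLeafNode n σ} =
      Nat.factorial j * j * (j + 1) ^ (k - j - 1) := by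
    rw [hL, hinj _ (fun ds h => ((mem_bsF_bsO j cs ds).1 (Finset.mem_sdiff.1 h).1).1),
      Finset.card_sdiff_of_subset hsub, (bs_total j cs hG).2 (by omega),
      (bs_nonleaf j cs hG).2 (by omega), hk, hpow, ← Nat.sub_sub]
    apply Nat.sub_eq_of_eq_add
    ring
  refine ⟨cL, cT, ?_⟩
  rw [cL, cT, hpow]
  ring
end
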